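/- Let λ > 0 and 0 < α < 1. There are constants b₀ > 0 and b₉, b₁₀ > 0 (the latter two depending on α and λ) such that for every finite connected transitive graph 𝔾 satisfying the triangle condition ∇_{p_c}(x,y) ≤ δ_{x,y} + a₀ with a₀ ≤ b₀ and λV^{1/3} ≥ b₀^{-1}, and for p = p_c + εΩ^{-1}: the percolation probability satisfies b₁₀·ε ≤ θ_α(p) whenever b₉V^{-1/3} ≤ ε ≤ 1, and θ_α(p) ≤ 27ε whenever εV^{1/3} ≥ 1 (and p ≤ 1). -/

import Mathlib

noncomputable section
open Classical

namespace Percolation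

variable {V : Type*} [Fintype V] [DecidableEq V]

/-- A percolation configuration: an assignment of occupied (`true`) or
vacant (`false`) to each bond of the graph. -/
def Config (G : SimpleGraph V) : Type _ := G.edgeSet → Bool

noncomputable instance (G : SimpleGraph V) : Fintype G.edgeSet :=
  Fintype.ofFinite _

noncomputable instance (G : SimpleGraph V) : Fintype (Config G) :=
  inferInstanceAs (Fintype (G.edgeSet → Bool))

/-- The probability weight of a configuration under the product Bernoulli
measure with parameter `p`. -/
def weight (G : SimpleGraph V) (p : ℝ) (ω : Config G) : ℝ :=
  ∏ e : G.edgeSet, if ω e then p else 1 - p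

/-- The probability of an event under the percolation measure `ℙ_p`. -/
def prob (G : SimpleGraph V) (p : ℝ) (A : Config G → Prop) : ℝ :=
  ∑ ω : Config G, if A ω then weight G p ω else 0

/-- The expectation of a random variable under the percolation measure `ℙ_p`. -/
def expect (G : SimpleGraph V) (p : ℝ) (f : Config G → ℝ) : ℝ :=
  ∑ ω : Config G, weight G p ω * f ω

/-- The subgraph consisting of the occupied bonds of a configuration. -/
def occupied (G : SimpleGraph V) (ω : Config G) : SimpleGraph V :=
  SimpleGraph.fromEdgeSet {e | ∃ h : e ∈ G.edgeSet, ω ⟨e, h⟩ = true}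

/-- The cluster `C(x)` of the vertex `x`: all vertices joined to `x` by a path
of occupied bonds (including `x` itself). -/
def cluster (G : SimpleGraph V) (ω : Config G) (x : V) : Finset V :=
  Finset.univ.filter fun y => (occupied G ω).Reachable x y

/-- The susceptibility `χ(p)`: the expected size of the cluster of `x₀`. -/
def chi (G : SimpleGraph V) (x₀ : V) (p : ℝ) : ℝ :=
  expect G p fun ω => ((cluster G ω x₀).card : ℝ)

/-- The two-point function `τ_p(x,y) = ℙ_p(x ↔ y)`. -/
def tau (G : SimpleGraph V) (p : ℝ) (x y : V) : ℝ :=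
  prob G p fun ω => (occupied G ω).Reachable x y

/-- The triangle diagram `∇_p(x,y)`. -/
def triangle (G : SimpleGraph V) (p : ℝ) (x y : V) : ℝ :=
  ∑ u : V, ∑ v : V, tau G p x u * tau G p u v * tau G p v y

/-- The Kronecker delta `δ_{x,y}`. -/
def kron (x y : V) : ℝ := if x = y then 1 else 0

/-- `∇̄_p`: the maximum of the triangle diagram over bonds `{x,y} ∈ 𝔹`. -/
def nablaBar (G : SimpleGraph V) (p : ℝ) : ℝ :=
  sSup {t : ℝ | ∃ x y : V, G.Adj x y ∧ t = triangle G p x y}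

/-- A graph is (vertex-)transitive if any vertex can be mapped to any other
by a graph automorphism. -/
def IsTransitive (G : SimpleGraph V) : Prop :=
  ∀ x y : V, ∃ φ : G ≃g G, φ x = y

/-- The size `|C_max|` of the largest cluster. -/
def maxCluster (G : SimpleGraph V) (ω : Config G) : ℕ :=
  Finset.univ.sup fun x => (cluster G ω x).card

/-- The cluster size distribution `P_{≥k}(p) = ℙ_p(|C(x₀)| ≥ k)`. -/
def Pgeq (G : SimpleGraph V) (x₀ : V) (p : ℝ) (k : ℝ) : ℝ :=
  prob G p fun ω => k ≤ ((cluster G ω x₀).card : ℝ)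

/-- The magnetization `M(p,γ)`. -/
def magnetization (G : SimpleGraph V) (x₀ : V) (p γ : ℝ) : ℝ :=
  ∑ k ∈ Finset.Icc 1 (Fintype.card V),
    (1 - (1 - γ) ^ k) * prob G p fun ω => (cluster G ω x₀).card = k

/-- `Z_{≥s}`: the number of vertices lying in clusters of size at least `s`. -/
def Zgeq (G : SimpleGraph V) (s : ℝ) (ω : Config G) : ℝ :=
  ∑ x : V, if s ≤ ((cluster G ω x).card : ℝ) then (1 : ℝ) else 0

/-- The variance of a random variable under `ℙ_p`. -/
def variance (G : SimpleGraph V) (p : ℝ) (f : Config G → ℝ) : ℝ :=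
  expect G p (fun ω => f ω ^ 2) - (expect G p f) ^ 2

/-- The restricted susceptibility `χ_{≥s}(p) = 𝔼_p[|C(x₀)| I[|C(x₀)| ≥ s]]`. -/
def chiGeq (G : SimpleGraph V) (x₀ : V) (p : ℝ) (s : ℝ) : ℝ :=
  expect G p fun ω =>
    if s ≤ ((cluster G ω x₀).card : ℝ) then ((cluster G ω x₀).card : ℝ) else 0

/-- The restricted susceptibility `χ_{<s}(p) = 𝔼_p[|C(x₀)| I[|C(x₀)| < s]]`. -/
def chiLt (G : SimpleGraph V) (x₀ : V) (p : ℝ) (s : ℝ) : ℝ :=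
  expect G p fun ω =>
    if ((cluster G ω x₀).card : ℝ) < s then ((cluster G ω x₀).card : ℝ) else 0

end Percolation

noncomputable section
open Classical
set_option linter.unusedSectionVars false

namespace PercProof

variable {ι : Type} [Fintype ι]

/-- Bernoulli weight of one coordinate. -/
def bw (p : ℝ) (b : Bool) : ℝ := if b then p else 1 - p

/-- Product weight. -/
def Wt (P : ι → ℝ) (ω : ι → Bool) : ℝ := ∏ i, bw (P i) (ω i)

/-- Expectation. -/
def Ew (P : ι → ℝ) (f : (ι → Bool) → ℝ) : ℝ := ∑ ω, Wt P ω * f ω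

/-- Indicator. -/
def ind (A : Prop) : ℝ := if A then 1 else 0

/-- Probability. -/
def Pr (P : ι → ℝ) (A : (ι → Bool) → Prop) : ℝ := Ew P (fun ω => ind (A ω))

lemma ind_nonneg (A : Prop) : 0 ≤ ind A := by unfold ind; split_ifs <;> norm_num
lemma ind_le_one (A : Prop) : ind A ≤ 1 := by unfold ind; split_ifs <;> norm_num
lemma ind_true {A : Prop} (h : A) : ind A = 1 := by simp [ind, h]
lemma ind_false {A : Prop} (h : ¬ A) : ind A = 0 := by simp [ind, h]
lemma ind_mono {A B : Prop} (h : A → B) : ind A ≤ ind B := by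
  unfold ind; split_ifs <;> first | tauto | norm_num
lemma ind_and (A B : Prop) : ind (A ∧ B) = ind A * ind B := by
  unfold ind; by_cases hA : A <;> by_cases hB : B <;> simp [hA, hB]
lemma ind_not (A : Prop) : ind (¬ A) = 1 - ind A := by
  unfold ind; by_cases hA : A <;> simp [hA]

lemma bw_nonneg {p : ℝ} (h0 : 0 ≤ p) (h1 : p ≤ 1) (b : Bool) : 0 ≤ bw p b := by
  unfold bw; split_ifs <;> linarith

lemma Wt_nonneg {P : ι → ℝ} (h0 : ∀ i, 0 ≤ P i) (h1 : ∀ i, P i ≤ 1) (ω) : 0 ≤ Wt P ω :=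
  Finset.prod_nonneg fun i _ => bw_nonneg (h0 i) (h1 i) _

lemma sum_Wt (P : ι → ℝ) : ∑ ω, Wt P ω = 1 := by
  have := (Finset.prod_univ_sum (fun _ : ι => (Finset.univ : Finset Bool))
    (fun i b => bw (P i) b)).symm
  rw [Fintype.piFinset_univ] at this
  unfold Wt
  rw [this]
  simp [bw]

lemma Ew_const (P : ι → ℝ) (c : ℝ) : Ew P (fun _ => c) = c := by
  unfold Ew; rw [← Finset.sum_mul, sum_Wt, one_mul]

lemma Ew_add (P : ι → ℝ) (f g) : Ew P (fun ω => f ω + g ω) = Ew P f + Ew P g := by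
  unfold Ew; rw [← Finset.sum_add_distrib]; congr 1; ext; ring

lemma Ew_sub (P : ι → ℝ) (f g) : Ew P (fun ω => f ω - g ω) = Ew P f - Ew P g := by
  unfold Ew; rw [← Finset.sum_sub_distrib]; congr 1; ext; ring

lemma Ew_mul_left (P : ι → ℝ) (c : ℝ) (f) : Ew P (fun ω => c * f ω) = c * Ew P f := by
  unfold Ew; rw [Finset.mul_sum]; congr 1; ext; ring

lemma Ew_mul_right (P : ι → ℝ) (c : ℝ) (f) : Ew P (fun ω => f ω * c) = Ew P f * c := by
  unfold Ew; rw [Finset.sum_mul]; congr 1; ext; ring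

lemma Ew_sum {κ : Type*} (P : ι → ℝ) (s : Finset κ) (f : κ → (ι → Bool) → ℝ) :
    Ew P (fun ω => ∑ k ∈ s, f k ω) = ∑ k ∈ s, Ew P (f k) := by
  unfold Ew; rw [Finset.sum_comm]; congr 1; ext; rw [Finset.mul_sum]

section mono

lemma Ew_mono {P : ι → ℝ} (h0 : ∀ i, 0 ≤ P i) (h1 : ∀ i, P i ≤ 1) {f g : (ι → Bool) → ℝ} (h : ∀ ω, f ω ≤ g ω) : Ew P f ≤ Ew P g :=
  Finset.sum_le_sum fun ω _ => mul_le_mul_of_nonneg_left (h ω) (Wt_nonneg h0 h1 ω)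

lemma Ew_nonneg {P : ι → ℝ} (h0 : ∀ i, 0 ≤ P i) (h1 : ∀ i, P i ≤ 1) {f : (ι → Bool) → ℝ} (h : ∀ ω, 0 ≤ f ω) : 0 ≤ Ew P f :=
  Finset.sum_nonneg fun ω _ => mul_nonneg (Wt_nonneg h0 h1 ω) (h ω)

lemma Pr_nonneg {P : ι → ℝ} (h0 : ∀ i, 0 ≤ P i) (h1 : ∀ i, P i ≤ 1) (A) : 0 ≤ Pr P A := Ew_nonneg h0 h1 fun _ => ind_nonneg _

lemma Pr_mono {P : ι → ℝ} (h0 : ∀ i, 0 ≤ P i) (h1 : ∀ i, P i ≤ 1) {A B : (ι → Bool) → Prop} (h : ∀ ω, A ω → B ω) : Pr P A ≤ Pr P B :=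
  Ew_mono h0 h1 fun ω => ind_mono (h ω)

lemma Pr_le_one {P : ι → ℝ} (h0 : ∀ i, 0 ≤ P i) (h1 : ∀ i, P i ≤ 1) (A) : Pr P A ≤ 1 := by
  calc Pr P A ≤ Ew P (fun _ => 1) := Ew_mono h0 h1 fun _ => ind_le_one _
    _ = 1 := Ew_const _ _

lemma Pr_union_bound {P : ι → ℝ} (h0 : ∀ i, 0 ≤ P i) (h1 : ∀ i, P i ≤ 1)
    {κ : Type*} (s : Finset κ) {A : (ι → Bool) → Prop}
    {B : κ → (ι → Bool) → Prop}
    (h : ∀ ω, A ω → ∃ k ∈ s, B k ω) : Pr P A ≤ ∑ k ∈ s, Pr P (B k) := by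
  unfold Pr
  rw [← Ew_sum]
  refine Ew_mono h0 h1 fun ω => ?_
  by_cases hA : A ω
  · obtain ⟨k, hk, hB⟩ := h ω hA
    rw [ind_true hA, ← ind_true hB]
    exact Finset.single_le_sum (f := fun k => ind (B k ω)) (fun k _ => ind_nonneg _) hk
  · rw [ind_false hA]
    exact Finset.sum_nonneg fun k _ => ind_nonneg _
end mono

/-- Merge two configurations. -/
def mrg (s : Set ι) (a b : ι → Bool) : ι → Bool := fun i => if i ∈ s then a i else b i

lemma mrg_invol (s : Set ι) (a b : ι → Bool) : mrg s (mrg s a b) (mrg s b a) = a := by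
  ext i; unfold mrg; split_ifs <;> rfl

/-- The swapping bijection. -/
def swp (s : Set ι) : ((ι → Bool) × (ι → Bool)) ≃ ((ι → Bool) × (ι → Bool)) where
  toFun x := (mrg s x.1 x.2, mrg s x.2 x.1)
  invFun x := (mrg s x.1 x.2, mrg s x.2 x.1)
  left_inv x := by simp [mrg_invol]
  right_inv x := by simp [mrg_invol]

lemma Ew_marg (s : Set ι) (P Q : ι → ℝ) (hPQ : ∀ i ∈ s, P i = Q i)
    (F : (ι → Bool) → (ι → Bool) → ℝ) :
    Ew P (fun ω => Ew Q (fun ω' => F (mrg s ω ω') (mrg s ω' ω))) =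
      Ew Q (fun a => Ew P (fun b => F a b)) := by
  have e1 : ∀ (P Q : ι → ℝ) (F : (ι → Bool) → (ι → Bool) → ℝ),
      Ew P (fun ω => Ew Q (fun ω' => F ω ω')) =
        ∑ x : (ι → Bool) × (ι → Bool), Wt P x.1 * Wt Q x.2 * F x.1 x.2 := by
    intro P Q F
    rw [Fintype.sum_prod_type]
    unfold Ew
    congr 1; ext ω
    rw [Finset.mul_sum]
    congr 1; ext; ring
  rw [e1, e1 Q P F]
  refine Fintype.sum_equiv (swp s) _ _ fun x => ?_
  have : Wt P x.1 * Wt Q x.2 = Wt Q (mrg s x.1 x.2) * Wt P (mrg s x.2 x.1) := by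
    unfold Wt
    rw [← Finset.prod_mul_distrib, ← Finset.prod_mul_distrib]
    refine Finset.prod_congr rfl fun i _ => ?_
    unfold mrg
    by_cases hi : i ∈ s
    · simp [hi, hPQ i hi]
    · simp [hi, mul_comm]
  simp only [swp, Equiv.coe_fn_mk]
  rw [this]

/-- `f` depends only on the coordinates in `s`. -/
def DepOn {β : Type*} (s : Set ι) (f : (ι → Bool) → β) : Prop :=
  ∀ ω ω', (∀ i ∈ s, ω i = ω' i) → f ω = f ω'

lemma Ew_congr_dep {s : Set ι} {P Q : ι → ℝ} (hPQ : ∀ i ∈ s, P i = Q i)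
    {f : (ι → Bool) → ℝ} (hf : DepOn s f) : Ew P f = Ew Q f := by
  have := Ew_marg s P Q hPQ (fun a _ => f a)
  simp only [Ew_const] at this
  rw [← this]
  congr 1; ext ω
  rw [← Ew_const Q (f ω)]
  congr 1; ext ω'
  apply hf
  intro i hi; simp [mrg, hi]

lemma Ew_indep {s : Set ι} {P : ι → ℝ} {f g : (ι → Bool) → ℝ} (hf : DepOn s f)
    (hg : DepOn sᶜ g) : Ew P (fun ω => f ω * g ω) = Ew P f * Ew P g := by
  have := Ew_marg s P P (fun _ _ => rfl) (fun a _ => f a * g a)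
  simp only [Ew_const] at this
  rw [← this, ← Ew_mul_right]
  congr 1; ext ω
  rw [← Ew_mul_left]
  congr 1; ext ω'
  congr 1
  · apply hf; intro i hi; simp [mrg, hi]
  · apply hg; intro i hi; simp only [Set.mem_compl_iff] at hi; simp [mrg, hi]

lemma Pr_indep {s : Set ι} {P : ι → ℝ} {A B : (ι → Bool) → Prop} (hf : DepOn s A)
    (hg : DepOn sᶜ B) : Pr P (fun ω => A ω ∧ B ω) = Pr P A * Pr P B := by
  unfold Pr
  simp only [ind_and]
  exact Ew_indep (fun ω ω' h => by rw [hf ω ω' h]) (fun ω ω' h => by rw [hg ω ω' h])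

lemma Wt_update (P : ι → ℝ) (ω : ι → Bool) (e : ι) (b : Bool) :
    Wt P (Function.update ω e b) = bw (P e) b * ∏ i ∈ Finset.univ.erase e, bw (P i) (ω i) := by
  unfold Wt
  rw [← Finset.mul_prod_erase _ _ (Finset.mem_univ e)]
  congr 1
  · simp
  · refine Finset.prod_congr rfl fun i hi => ?_
    rw [Function.update_of_ne (Finset.ne_of_mem_erase hi)]

lemma Pr_coord (P : ι → ℝ) (e : ι) : Pr P (fun ω => ω e = true) = P e := by
  unfold Pr
  have h2 := Finset.prod_univ_sum (fun _ : ι => (Finset.univ : Finset Bool))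
    (fun i b => bw (P i) b * (if i = e then ind (b = true) else 1))
  rw [Fintype.piFinset_univ] at h2
  have h3 : Ew P (fun ω => ind (ω e = true)) =
      ∑ x : ι → Bool, ∏ i, bw (P i) (x i) * (if i = e then ind (x i = true) else 1) := by
    unfold Ew Wt
    refine Finset.sum_congr rfl fun x _ => ?_
    rw [Finset.prod_mul_distrib, Finset.prod_ite_eq']
    simp
  rw [h3, ← h2, Finset.prod_eq_single e]
  · simp [bw, ind]
  · intro i _ hi; simp [hi, bw]
  · simp

/-- Split along one coordinate. -/
lemma Ew_split (P : ι → ℝ) (e : ι) (f : (ι → Bool) → ℝ) :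
    Ew P f = P e * Ew P (fun ω => f (Function.update ω e true)) +
      (1 - P e) * Ew P (fun ω => f (Function.update ω e false)) := by
  have hd : ∀ b, DepOn ({e}ᶜ) (fun ω : ι → Bool => f (Function.update ω e b)) := by
    intro b ω ω' h
    dsimp only
    congr 1; ext i
    by_cases hi : i = e
    · subst hi; simp
    · simp only [Function.update_of_ne hi]; exact h i hi
  have hd2 : ∀ b, DepOn {e} (fun ω : ι → Bool => ind (ω e = b)) := by
    intro b ω ω' h; simp only [h e rfl]
  have e1 : Ew P f = Ew P (fun ω => ind (ω e = true) * f (Function.update ω e true) +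
      ind (ω e = false) * f (Function.update ω e false)) := by
    congr 1; ext ω
    cases h : ω e
    · rw [ind_false (by simp), ind_true rfl, ← h, Function.update_eq_self]; ring
    · rw [ind_true rfl, ind_false (by simp), ← h, Function.update_eq_self]; ring
  have e2 := Pr_coord P e
  have e3 : Ew P (fun ω => ind (ω e = false)) = 1 - P e := by
    rw [← e2, Pr, ← Ew_const P 1, ← Ew_sub]
    congr 1; ext ω; cases ω e <;> simp [ind]
  rw [e1, Ew_add, Ew_indep (hd2 _) (hd _), Ew_indep (hd2 _) (hd _), e3]
  rw [show Ew P (fun ω => ind (ω e = true)) = P e from e2]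

/-- Homogeneous expectation. -/
abbrev E (p : ℝ) (f : (ι → Bool) → ℝ) : ℝ := Ew (fun _ => p) f

/-- Russo's formula. -/
lemma russo (f : (ι → Bool) → ℝ) (p : ℝ) :
    HasDerivAt (fun p => E p f)
      (∑ e, E p (fun ω => f (Function.update ω e true) - f (Function.update ω e false))) p := by
  have h1 : ∀ ω : ι → Bool, HasDerivAt (fun p => Wt (fun _ => p) ω * f ω)
      ((∑ e, (∏ i ∈ Finset.univ.erase e, bw p (ω i)) • (if ω e then (1:ℝ) else -1)) * f ω) p := by
    intro ω
    refine HasDerivAt.mul_const ?_ _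
    unfold Wt
    refine HasDerivAt.fun_finsetProd fun e _ => ?_
    unfold bw
    by_cases h : ω e
    · simp only [h, if_true]; exact hasDerivAt_id p
    · simp only [h]; simpa using (hasDerivAt_id p).const_sub 1
  have h2 := HasDerivAt.fun_sum (u := Finset.univ) fun ω (_ : ω ∈ Finset.univ) => h1 ω
  unfold E Ew
  refine h2.congr_deriv ?_
  simp only [Finset.sum_mul]
  rw [Finset.sum_comm]
  refine Finset.sum_congr rfl fun e _ => Eq.symm ?_
  have h3 := Ew_split (fun i => if i = e then (1/2 : ℝ) else p) e
    (fun ω => (if ω e then (1:ℝ) else -1) * f ω * 2)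
  have h4 : ∑ x : ι → Bool, (∏ i ∈ Finset.univ.erase e, bw p (x i)) • (if x e then (1:ℝ) else -1) * f x
      = Ew (fun i => if i = e then (1/2 : ℝ) else p) (fun ω => (if ω e then (1:ℝ) else -1) * f ω * 2) := by
    unfold Ew Wt
    refine Finset.sum_congr rfl fun x _ => ?_
    rw [← Finset.mul_prod_erase _ _ (Finset.mem_univ e)]
    have : ∏ i ∈ Finset.univ.erase e, bw (if i = e then (1/2 : ℝ) else p) (x i) =
        ∏ i ∈ Finset.univ.erase e, bw p (x i) :=
      Finset.prod_congr rfl fun i hi => by rw [if_neg (Finset.ne_of_mem_erase hi)]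
    rw [this]
    have : bw (if e = e then (1/2 : ℝ) else p) (x e) = 1/2 := by
      rw [if_pos rfl]; unfold bw; split_ifs <;> norm_num
    rw [this]; simp only [smul_eq_mul]; ring
  rw [h4, h3]
  have hd : ∀ b, DepOn ({e}ᶜ) (fun ω : ι → Bool => f (Function.update ω e b)) := by
    intro b ω ω' h
    dsimp only
    congr 1; ext i
    by_cases hi : i = e
    · subst hi; simp
    · simp only [Function.update_of_ne hi]; exact h i hi
  have h5 : ∀ b, Ew (fun i => if i = e then (1/2 : ℝ) else p) (fun ω => f (Function.update ω e b)) =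
      Ew (fun _ => p) (fun ω => f (Function.update ω e b)) := by
    intro b
    refine Ew_congr_dep (s := {e}ᶜ) ?_ (hd b)
    intro i hi; simp only [Set.mem_compl_iff, Set.mem_singleton_iff] at hi; simp [hi]
  change Ew (fun _ => p) _ = _
  simp only [Function.update_self, if_true]
  rw [Ew_sub, ← h5, ← h5]
  simp only [one_mul, Ew_mul_right]
  simp only [Bool.false_eq_true, if_false, neg_mul, one_mul]
  have : Ew (fun i => if i = e then (1/2 : ℝ) else p) (fun ω => -f (Function.update ω e false)) =
    - Ew (fun i => if i = e then (1/2 : ℝ) else p) (fun ω => f (Function.update ω e false)) := by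
    have := Ew_mul_left (fun i => if i = e then (1/2 : ℝ) else p) (-1) (fun ω => f (Function.update ω e false))
    simpa using this
  rw [this]; norm_num; ring

/-- Increasing functions have increasing expectations. -/
lemma E_mono_p {f : (ι → Bool) → ℝ} (hf : Monotone f) {p q : ℝ} (h0 : 0 ≤ p) (hpq : p ≤ q)
    (h1 : q ≤ 1) : E p f ≤ E q f := by
  have : MonotoneOn (fun p => E p f) (Set.Icc 0 1) := by
    apply monotoneOn_of_deriv_nonneg (convex_Icc 0 1)
    · exact fun x _ => (russo f x).continuousAt.continuousWithinAt
    · exact fun x _ => (russo f x).differentiableAt.differentiableWithinAt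
    · intro x hx
      rw [interior_Icc] at hx
      rw [(russo f x).deriv]
      refine Finset.sum_nonneg fun e _ => Ew_nonneg (fun _ => hx.1.le) (fun _ => hx.2.le) fun ω => ?_
      rw [sub_nonneg]
      apply hf
      intro i
      by_cases hi : i = e
      · subst hi; simp
      · simp [Function.update_of_ne hi]
  exact this ⟨h0, hpq.trans h1⟩ ⟨h0.trans hpq, h1⟩ hpq

end PercProof
end

noncomputable section
open Classical
set_option linter.unusedSectionVars false

namespace PercProof

variable {ι : Type} [Fintype ι]

/-- Disjoint occurrence. -/
def Dj (A B : (ι → Bool) → Prop) (ω : ι → Bool) : Prop :=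
  ∃ η ζ : ι → Bool, η ≤ ω ∧ ζ ≤ ω ∧ (∀ i, ¬ (η i = true ∧ ζ i = true)) ∧ A η ∧ B ζ

lemma Dj_mono (A B : (ι → Bool) → Prop) : Monotone (Dj A B) := by
  rintro ω ω' h ⟨η, ζ, h1, h2, h3⟩
  exact ⟨η, ζ, h1.trans h, h2.trans h, h3⟩

lemma upd_mono (e : ι) (b : Bool) : Monotone (fun ω : ι → Bool => Function.update ω e b) := by
  intro ω ω' h i
  by_cases hi : i = e
  · subst hi; simp
  · simpa [Function.update_of_ne hi] using h i

lemma upd_false_le (e : ι) (ω : ι → Bool) : Function.update ω e false ≤ ω := by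
  intro i
  by_cases hi : i = e
  · subst hi; simp
  · simp [Function.update_of_ne hi]

lemma le_upd_true (e : ι) (ω : ι → Bool) : ω ≤ Function.update ω e true := by
  intro i
  by_cases hi : i = e
  · subst hi; simp
  · simp [Function.update_of_ne hi]

lemma upd_false_eq {e : ι} {η : ι → Bool} (h : η e = false) : Function.update η e false = η := by
  rw [← h, Function.update_eq_self]

lemma upd_false_le_of_le_true {e : ι} {η ω : ι → Bool} (h : η ≤ Function.update ω e true) :
    Function.update η e false ≤ ω := by
  intro i
  by_cases hi : i = e
  · subst hi; simp
  · simpa [Function.update_of_ne hi] using h i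

lemma Dj_upd_false {A B : (ι → Bool) → Prop} {e : ι} {ω : ι → Bool}
    (h : Dj A B (Function.update ω e false)) :
    Dj (fun ω => A (Function.update ω e false)) (fun ω => B (Function.update ω e false)) ω := by
  obtain ⟨η, ζ, h1, h2, h3, hA, hB⟩ := h
  have a1 : η e = false := by
    have := h1 e; rw [Function.update_self] at this; exact le_bot_iff.mp this
  have a2 : ζ e = false := by
    have := h2 e; rw [Function.update_self] at this; exact le_bot_iff.mp this
  refine ⟨η, ζ, h1.trans (upd_false_le _ _), h2.trans (upd_false_le _ _), h3, ?_, ?_⟩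
  · simpa only [upd_false_eq a1] using hA
  · simpa only [upd_false_eq a2] using hB

lemma Dj_upd_true {A B : (ι → Bool) → Prop} (mA : Monotone A) (mB : Monotone B)
    {e : ι} {ω : ι → Bool}
    (h : Dj A B (Function.update ω e true)) :
    Dj (fun ω => A (Function.update ω e false)) (fun ω => B (Function.update ω e true)) ω ∨
    Dj (fun ω => A (Function.update ω e true)) (fun ω => B (Function.update ω e false)) ω := by
  obtain ⟨η, ζ, h1, h2, h3, hA, hB⟩ := h
  have key : ∀ i, ¬ (Function.update η e false i = true ∧ Function.update ζ e false i = true) := by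
    intro i hi
    by_cases hie : i = e
    · subst hie; simp at hi
    · simp only [Function.update_of_ne hie] at hi; exact h3 i hi
  cases hη : η e
  · left
    refine ⟨_, _, upd_false_le_of_le_true h1, upd_false_le_of_le_true h2, key, ?_, ?_⟩
    · simpa [upd_false_eq hη] using hA
    · simpa using mB (le_upd_true e ζ) hB
  · right
    have hζ : ζ e = false := by
      have := h3 e; simp [hη] at this; simpa using this
    refine ⟨_, _, upd_false_le_of_le_true h1, upd_false_le_of_le_true h2, key, ?_, ?_⟩
    · simpa using mA (le_upd_true e η) hA
    · simpa [upd_false_eq hζ] using hB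

lemma Dj_imp {A B A' B' : (ι → Bool) → Prop} (hA : ∀ ω, A ω → A' ω) (hB : ∀ ω, B ω → B' ω)
    {ω} (h : Dj A B ω) : Dj A' B' ω := by
  obtain ⟨η, ζ, h1, h2, h3, a, b⟩ := h
  exact ⟨η, ζ, h1, h2, h3, hA _ a, hB _ b⟩

lemma BK_aux {p : ℝ} (h0 : 0 ≤ p) (h1 : p ≤ 1/2) (s : Finset ι) :
    ∀ A B : (ι → Bool) → Prop, Monotone A → Monotone B → DepOn (s : Set ι) A →
      DepOn (s : Set ι) B →
      Pr (fun _ => p) (Dj A B) ≤ Pr (fun _ => p) A * Pr (fun _ => p) B := by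
  have q1 : p ≤ 1 := by linarith
  induction s using Finset.induction_on with
  | empty =>
    intro A B mA mB dA dB
    have hA : ∀ ω, A ω = A (fun _ => false) := fun ω => dA _ _ (by simp)
    have hB : ∀ ω, B ω = B (fun _ => false) := fun ω => dB _ _ (by simp)
    have e1 : Pr (fun _ => p) A = ind (A fun _ => false) := by
      unfold Pr; simp only [hA]; rw [Ew_const]
    have e2 : Pr (fun _ => p) B = ind (B fun _ => false) := by
      unfold Pr; simp only [hB]; rw [Ew_const]
    rw [e1, e2, ← ind_and, ← Ew_const (fun _ : ι => p) (ind _)]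
    refine Ew_mono (fun _ => h0) (fun _ => q1) fun ω => ind_mono ?_
    rintro ⟨η, ζ, -, -, -, a, b⟩
    exact ⟨by rwa [← hA η], by rwa [← hB ζ]⟩
  | insert e s he ih =>
    intro A B mA mB dA dB
    have mU : ∀ {A : (ι → Bool) → Prop} (b), Monotone A →
        Monotone (fun ω => A (Function.update ω e b)) := fun b hA => hA.comp (upd_mono e b)
    have dU : ∀ {A : (ι → Bool) → Prop} (b), DepOn (↑(insert e s) : Set ι) A →
        DepOn (s : Set ι) (fun ω => A (Function.update ω e b)) := by
      intro A b hA ω ω' h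
      apply hA
      intro i hi
      by_cases hie : i = e
      · subst hie; simp
      · simp only [Function.update_of_ne hie]
        apply h
        simpa [hie] using hi
    have i00 := ih _ _ (mU false mA) (mU false mB) (dU false dA) (dU false dB)
    have i01 := ih _ _ (mU false mA) (mU true mB) (dU false dA) (dU true dB)
    have i10 := ih _ _ (mU true mA) (mU false mB) (dU true dA) (dU false dB)
    set P : ι → ℝ := fun _ => p with hP
    set A0 : (ι → Bool) → Prop := fun ω => A (Function.update ω e false)
    set A1 : (ι → Bool) → Prop := fun ω => A (Function.update ω e true)
    set B0 : (ι → Bool) → Prop := fun ω => B (Function.update ω e false)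
    set B1 : (ι → Bool) → Prop := fun ω => B (Function.update ω e true)
    have sA : Pr P A = p * Pr P A1 + (1 - p) * Pr P A0 := Ew_split P e _
    have sB : Pr P B = p * Pr P B1 + (1 - p) * Pr P B0 := Ew_split P e _
    have sAB : Pr P (Dj A B) = p * Pr P (fun ω => Dj A B (Function.update ω e true)) +
      (1 - p) * Pr P (fun ω => Dj A B (Function.update ω e false)) := Ew_split P e _
    have A01 : ∀ ω, A0 ω → A1 ω := fun ω h => mA ((upd_false_le e ω).trans (le_upd_true e ω)) h
    have B01 : ∀ ω, B0 ω → B1 ω := fun ω h => mB ((upd_false_le e ω).trans (le_upd_true e ω)) h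
    have t0 : Pr P (fun ω => Dj A B (Function.update ω e false)) ≤ Pr P (Dj A0 B0) :=
      Pr_mono (fun _ => h0) (fun _ => q1) fun ω h => Dj_upd_false h
    have t1 : Pr P (fun ω => Dj A B (Function.update ω e true)) ≤
        Pr P (Dj A0 B1) + Pr P (Dj A1 B0) - Pr P (Dj A0 B0) := by
      unfold Pr
      rw [← Ew_add, ← Ew_sub]
      refine Ew_mono (fun _ => h0) (fun _ => q1) fun ω => ?_
      by_cases h00 : Dj A0 B0 ω
      · rw [ind_true h00, ind_true (Dj_imp (fun _ h => h) B01 h00),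
          ind_true (Dj_imp A01 (fun _ h => h) h00)]
        linarith [ind_le_one (Dj A B (Function.update ω e true))]
      · rw [ind_false h00]
        by_cases h : Dj A B (Function.update ω e true)
        · rcases Dj_upd_true mA mB h with h' | h'
          · rw [ind_true h, ind_true h']; linarith [ind_nonneg (Dj A1 B0 ω)]
          · rw [ind_true h, ind_true h']; linarith [ind_nonneg (Dj A0 B1 ω)]
        · rw [ind_false h]; linarith [ind_nonneg (Dj A1 B0 ω), ind_nonneg (Dj A0 B1 ω)]
    have a01 : Pr P A0 ≤ Pr P A1 := Pr_mono (fun _ => h0) (fun _ => q1) A01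
    have b01 : Pr P B0 ≤ Pr P B1 := Pr_mono (fun _ => h0) (fun _ => q1) B01
    rw [sAB, sA, sB]
    have u1 := mul_le_mul_of_nonneg_left t1 h0
    have u2 := mul_le_mul_of_nonneg_left t0 (by linarith : 0 ≤ 1 - p)
    have u3 := mul_le_mul_of_nonneg_left i01 h0
    have u4 := mul_le_mul_of_nonneg_left i10 h0
    have u5 := mul_le_mul_of_nonneg_left i00 (by linarith : 0 ≤ 1 - 2 * p)
    have u6 : 0 ≤ p ^ 2 * ((Pr P A1 - Pr P A0) * (Pr P B1 - Pr P B0)) :=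
      mul_nonneg (sq_nonneg p) (mul_nonneg (by linarith) (by linarith))
    nlinarith [u1, u2, u3, u4, u5, u6]

/-- The BK inequality (for `p ≤ 1/2`). -/
lemma BK {p : ℝ} (h0 : 0 ≤ p) (h1 : p ≤ 1/2) {A B : (ι → Bool) → Prop} (mA : Monotone A)
    (mB : Monotone B) :
    Pr (fun _ => p) (Dj A B) ≤ Pr (fun _ => p) A * Pr (fun _ => p) B := by
  refine BK_aux h0 h1 Finset.univ A B mA mB ?_ ?_ <;>
  · intro ω ω' h
    have : ω = ω' := by ext i; rw [h i (by simp)]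
    rw [this]

lemma BK3 {p : ℝ} (h0 : 0 ≤ p) (h1 : p ≤ 1/2) {A B C : (ι → Bool) → Prop} (mA : Monotone A)
    (mB : Monotone B) (mC : Monotone C) :
    Pr (fun _ => p) (Dj A (Dj B C)) ≤
      Pr (fun _ => p) A * (Pr (fun _ => p) B * Pr (fun _ => p) C) :=
  (BK h0 h1 mA (Dj_mono B C)).trans
    (mul_le_mul_of_nonneg_left (BK h0 h1 mB mC)
      (Pr_nonneg (fun _ => h0) (fun _ => by linarith) _))

/-- Set one coordinate. -/
def up (ω : ι → Bool) (e : ι) (b : Bool) : ι → Bool := fun i => if i = e then b else ω i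

lemma up_same (ω : ι → Bool) (e : ι) (b : Bool) : up ω e b e = b := by simp [up]

lemma up_ne (ω : ι → Bool) {e i : ι} (h : i ≠ e) (b : Bool) : up ω e b i = ω i := by simp [up, h]

lemma up_eq (ω : ι → Bool) (e : ι) (b : Bool) : up ω e b = Function.update ω e b := by
  ext i
  by_cases hi : i = e
  · subst hi; rw [up_same, Function.update_self]
  · rw [up_ne _ hi, Function.update_of_ne hi]

lemma up_up (ω : ι → Bool) (e : ι) (b c : Bool) : up (up ω e b) e c = up ω e c := by
  ext i
  by_cases hi : i = e
  · subst hi; rw [up_same, up_same]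
  · rw [up_ne _ hi, up_ne _ hi, up_ne _ hi]

lemma le_up_true (e : ι) (ω : ι → Bool) : ω ≤ up ω e true := by
  rw [up_eq]; exact le_upd_true e ω

/-- Derivative of the expectation. -/
def dE (p : ℝ) (f : (ι → Bool) → ℝ) : ℝ :=
  ∑ e, E p (fun ω => f (up ω e true) - f (up ω e false))

lemma russo_up (f : (ι → Bool) → ℝ) (p : ℝ) : HasDerivAt (fun p => E p f) (dE p f) p := by
  unfold dE
  simp only [up_eq]
  exact russo f p

lemma Ew_split_up (P : ι → ℝ) (e : ι) (f : (ι → Bool) → ℝ) :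
    Ew P f = P e * Ew P (fun ω => f (up ω e true)) +
      (1 - P e) * Ew P (fun ω => f (up ω e false)) := by
  simp only [up_eq]
  exact Ew_split P e f

end PercProof
end

noncomputable section
open Classical
set_option linter.unusedSectionVars false

namespace PercProof
open Percolation

variable {V : Type} [Fintype V] [DecidableEq V] {G : SimpleGraph V}

/-- Occupied graph. -/
def O (ω : G.edgeSet → Bool) : SimpleGraph V := occupied G ω

lemma O_adj {ω : G.edgeSet → Bool} {x y : V} :
    (O ω).Adj x y ↔ ∃ h : s(x, y) ∈ G.edgeSet, ω ⟨s(x, y), h⟩ = true := by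
  unfold O occupied
  rw [SimpleGraph.fromEdgeSet_adj]
  constructor
  · rintro ⟨h, -⟩; exact h
  · rintro ⟨h, h'⟩
    exact ⟨⟨h, h'⟩, G.ne_of_adj h⟩

/-- Occupied graph restricted to `S`. -/
def OS (ω : G.edgeSet → Bool) (S : Set V) : SimpleGraph V where
  Adj x y := (O ω).Adj x y ∧ x ∈ S ∧ y ∈ S
  symm := ⟨fun _ _ h => ⟨h.1.symm, h.2.2, h.2.1⟩⟩
  loopless := ⟨fun _ h => h.1.ne rfl⟩

/-- Connection. -/
def Cn (ω : G.edgeSet → Bool) (x y : V) : Prop := (O ω).Reachable x y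

/-- Connection inside `S`. -/
def CnS (S : Set V) (ω : G.edgeSet → Bool) (x y : V) : Prop := (OS ω S).Reachable x y

lemma O_mono {ω ω' : G.edgeSet → Bool} (h : ω ≤ ω') : O ω ≤ O ω' := by
  intro x y hxy
  rw [O_adj] at *
  obtain ⟨h1, h2⟩ := hxy
  refine ⟨h1, ?_⟩
  have := h ⟨s(x,y), h1⟩
  rw [h2] at this
  exact top_le_iff.mp this

lemma Cn_mono (x y : V) : Monotone (fun ω : G.edgeSet → Bool => Cn ω x y) :=
  fun _ _ h hc => SimpleGraph.Reachable.mono (O_mono h) hc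

lemma CnS_mono (S : Set V) (x y : V) : Monotone (fun ω : G.edgeSet → Bool => CnS S ω x y) :=
  fun ω ω' h hc => SimpleGraph.Reachable.mono (G := OS ω S) (G' := OS ω' S)
    (fun _ _ hh => ⟨O_mono h hh.1, hh.2⟩) hc

lemma CnS_Cn {S : Set V} {ω : G.edgeSet → Bool} {x y : V} (h : CnS S ω x y) : Cn ω x y :=
  SimpleGraph.Reachable.mono (G := OS ω S) (fun _ _ hh => hh.1) h

lemma Cn_symm {ω : G.edgeSet → Bool} {x y : V} (h : Cn ω x y) : Cn ω y x :=
  SimpleGraph.Reachable.symm h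

lemma Cn_trans {ω : G.edgeSet → Bool} {x y z : V} (h : Cn ω x y) (h' : Cn ω y z) : Cn ω x z :=
  SimpleGraph.Reachable.trans h h'

/-- Configuration with open set `F`. -/
def cfg (F : Set (Sym2 V)) : G.edgeSet → Bool := fun e => decide (e.1 ∈ F)

lemma cfg_mono {F F' : Set (Sym2 V)} (h : F ⊆ F') : (cfg F : G.edgeSet → Bool) ≤ cfg F' := by
  intro e
  simp only [cfg]
  by_cases h1 : e.1 ∈ F
  · simp [h1, h h1]
  · simp [h1]

lemma cfg_le {F : Set (Sym2 V)} {ω : G.edgeSet → Bool}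
    (h : ∀ e ∈ F, e ∈ (O ω).edgeSet) : cfg F ≤ ω := by
  intro e
  simp only [cfg]
  by_cases h1 : e.1 ∈ F
  · have h2 := h _ h1
    obtain ⟨e, he⟩ := e
    induction e with | _ x y =>
    rw [SimpleGraph.mem_edgeSet, O_adj] at h2
    obtain ⟨_, h3⟩ := h2
    simp [h3]
  · simp [h1]

lemma cfg_disj {F F' : Set (Sym2 V)} (h : Disjoint F F') (i : G.edgeSet) :
    ¬ ((cfg F : G.edgeSet → Bool) i = true ∧ (cfg F' : G.edgeSet → Bool) i = true) := by
  simp only [cfg, decide_eq_true_eq]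
  rintro ⟨h1, h2⟩
  exact Set.disjoint_left.mp h h1 h2

lemma O_le (ω : G.edgeSet → Bool) {x y : V} (h : (O ω).Adj x y) : G.Adj x y := by
  rw [O_adj] at h; exact h.1

lemma Cn_cfg {ω : G.edgeSet → Bool} {x y : V} (w : (O ω).Walk x y) {F : Set (Sym2 V)}
    (h : ∀ e ∈ w.edges, e ∈ F) : Cn (cfg F : G.edgeSet → Bool) x y := by
  refine ⟨w.transfer _ ?_⟩
  intro e he
  have h1 := h e he
  have h2 := w.edges_subset_edgeSet he
  induction e with | _ x y =>
  rw [SimpleGraph.mem_edgeSet] at *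
  rw [O_adj]
  exact ⟨O_le ω h2, by simpa [cfg] using h1⟩

lemma CnS_cfg {ω : G.edgeSet → Bool} {S : Set V} {x y : V} (w : (OS ω S).Walk x y)
    {F : Set (Sym2 V)}
    (h : ∀ e ∈ w.edges, e ∈ F) : CnS S (cfg F : G.edgeSet → Bool) x y := by
  refine ⟨w.transfer _ ?_⟩
  intro e he
  have h1 := h e he
  have h2 := w.edges_subset_edgeSet he
  induction e with | _ x y =>
  rw [SimpleGraph.mem_edgeSet] at *
  refine ⟨?_, h2.2⟩
  rw [O_adj]
  exact ⟨O_le ω h2.1, by simpa [cfg] using h1⟩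

lemma first_hit {H : SimpleGraph V} {S : Set V} {w t : V} (q : H.Walk w t) (ht : t ∈ S) :
    ∃ z ∈ S, ∃ q' : H.Walk w z, ∀ e ∈ q'.edges, ∃ a ∈ e, a ∉ S := by
  induction q with
  | nil => exact ⟨_, ht, .nil, by simp⟩
  | @cons a b c h q ih =>
    by_cases ha : a ∈ S
    · exact ⟨a, ha, .nil, by simp⟩
    · obtain ⟨z, hz, q', hq'⟩ := ih ht
      refine ⟨z, hz, .cons h q', ?_⟩
      intro e he
      rw [SimpleGraph.Walk.edges_cons, List.mem_cons] at he
      rcases he with rfl | he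
      · exact ⟨a, by simp, ha⟩
      · exact hq' e he

/-- Deterministic tree-graph statement. -/
lemma tree_det {ω : G.edgeSet → Bool} {a u w : V} (hu : Cn ω a u) (hw : Cn ω a w) :
    ∃ z, Dj (fun ω => Cn ω a z) (Dj (fun ω => Cn ω z u) (fun ω => Cn ω z w)) ω := by
  obtain ⟨P, hP⟩ := SimpleGraph.Reachable.exists_isPath hu
  obtain ⟨Q⟩ := Cn_symm hw
  obtain ⟨z, hz, Q', hQ'⟩ := first_hit (S := {v | v ∈ P.support}) Q P.start_mem_support
  have hz : z ∈ P.support := hz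
  have hnd := hP.isTrail.edges_nodup
  rw [← P.take_spec hz, SimpleGraph.Walk.edges_append, List.nodup_append] at hnd
  have hPQ : ∀ e ∈ P.edges, e ∉ Q'.edges := by
    intro e he hq
    obtain ⟨a, ha, ha'⟩ := hQ' e hq
    exact ha' (P.mem_support_of_mem_edges he ha)
  set I : Set (Sym2 V) := {e | e ∈ (P.takeUntil z hz).edges}
  set J : Set (Sym2 V) := {e | e ∈ (P.dropUntil z hz).edges}
  set K : Set (Sym2 V) := {e | e ∈ Q'.edges}
  have hIJ : Disjoint I J := Set.disjoint_left.mpr fun e h1 h2 => hnd.2.2 e h1 e h2 rfl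
  have hIK : Disjoint I K := Set.disjoint_left.mpr fun e h1 h2 =>
    hPQ e (P.edges_takeUntil_subset_edges hz h1) h2
  have hJK : Disjoint J K := Set.disjoint_left.mpr fun e h1 h2 =>
    hPQ e (P.edges_dropUntil_subset_edges hz h1) h2
  refine ⟨z, cfg I, cfg (J ∪ K), cfg_le ?_, cfg_le ?_, cfg_disj (hIJ.union_right hIK), ?_,
    cfg J, cfg K, cfg_mono Set.subset_union_left, cfg_mono Set.subset_union_right,
    cfg_disj hJK, ?_, ?_⟩
  · intro e he; exact (P.takeUntil z hz).edges_subset_edgeSet he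
  · rintro e (he | he)
    · exact (P.dropUntil z hz).edges_subset_edgeSet he
    · exact Q'.edges_subset_edgeSet he
  · exact Cn_cfg (P.takeUntil z hz) (fun e he => he)
  · exact Cn_cfg (P.dropUntil z hz) (fun e he => he)
  · exact Cn_symm (Cn_cfg Q' (fun e he => he))

lemma reach_OS {ω : G.edgeSet → Bool} {S : Set V} {x y : V} (w : (O ω).Walk x y)
    (h : ∀ v ∈ w.support, v ∈ S) : CnS S ω x y := by
  induction w with
  | nil => exact SimpleGraph.Reachable.refl _
  | @cons a b c hab q ih =>
    have h1 : (OS ω S).Adj a b := ⟨hab, h a (by simp), h b (by simp)⟩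
    exact h1.reachable.trans (ih fun v hv => h v (by simp [hv]))

lemma through_det {ω : G.edgeSet → Bool} {A : Set V} {v x : V} (h : Cn ω v x)
    (h' : ¬ CnS Aᶜ ω v x) : ∃ w ∈ A, Dj (fun ω => Cn ω v w) (fun ω => Cn ω w x) ω := by
  obtain ⟨P, hP⟩ := SimpleGraph.Reachable.exists_isPath h
  have : ∃ z ∈ P.support, z ∈ A := by
    by_contra hc
    push Not at hc
    exact h' (reach_OS P hc)
  obtain ⟨z, hz, hzA⟩ := this
  have hnd := hP.isTrail.edges_nodup
  rw [← P.take_spec hz, SimpleGraph.Walk.edges_append, List.nodup_append] at hnd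
  set I : Set (Sym2 V) := {e | e ∈ (P.takeUntil z hz).edges}
  set J : Set (Sym2 V) := {e | e ∈ (P.dropUntil z hz).edges}
  have hIJ : Disjoint I J := Set.disjoint_left.mpr fun e h1 h2 => hnd.2.2 e h1 e h2 rfl
  refine ⟨z, hzA, cfg I, cfg J, cfg_le ?_, cfg_le ?_, cfg_disj hIJ, ?_, ?_⟩
  · intro e he; exact (P.takeUntil z hz).edges_subset_edgeSet he
  · intro e he; exact (P.dropUntil z hz).edges_subset_edgeSet he
  · exact Cn_cfg (P.takeUntil z hz) (fun e he => he)
  · exact Cn_cfg (P.dropUntil z hz) (fun e he => he)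

lemma exit_walk {ω : G.edgeSet → Bool} {S : Set V} {a z : V} (P : (O ω).Walk a z) (ha : a ∈ S) :
    CnS S ω a z ∨ ∃ x y, x ∈ S ∧ y ∉ S ∧ (O ω).Adj x y ∧ ∃ (P1 : (OS ω S).Walk a x)
      (P2 : (O ω).Walk y z), P.edges = P1.edges ++ s(x, y) :: P2.edges := by
  induction P with
  | nil => left; exact SimpleGraph.Reachable.refl _
  | @cons a b c hab q ih =>
    by_cases hb : b ∈ S
    · have h1 : (OS ω S).Adj a b := ⟨hab, ha, hb⟩
      rcases ih hb with h | ⟨x, y, hx, hy, hxy, P1, P2, he⟩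
      · left; exact h1.reachable.trans h
      · right
        refine ⟨x, y, hx, hy, hxy, .cons h1 P1, P2, ?_⟩
        simp [he]
    · right
      exact ⟨a, b, ha, hb, hab, .nil, q, by simp⟩

/-- The edge `xy` is open. -/
def Op (x y : V) (ω : G.edgeSet → Bool) : Prop := (O ω).Adj x y

lemma Op_mono (x y : V) : Monotone (Op x y : (G.edgeSet → Bool) → Prop) :=
  fun _ _ h hc => O_mono h hc

lemma exit_det {ω : G.edgeSet → Bool} {S : Set V} {a z : V} (ha : a ∈ S) (h : Cn ω a z)
    (h' : ¬ CnS S ω a z) : ∃ x y, x ∈ S ∧ y ∉ S ∧ G.Adj x y ∧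
      Dj (fun ω => CnS S ω a x) (Dj (Op x y) (fun ω => Cn ω y z)) ω := by
  obtain ⟨P, hP⟩ := SimpleGraph.Reachable.exists_isPath h
  rcases exit_walk P ha with h | ⟨x, y, hx, hy, hxy, P1, P2, he⟩
  · exact absurd h h'
  have hnd := hP.isTrail.edges_nodup
  have hsub := P.edges_subset_edgeSet
  rw [he] at hnd hsub
  rw [List.nodup_append, List.nodup_cons] at hnd
  set I : Set (Sym2 V) := {e | e ∈ P1.edges}
  set J : Set (Sym2 V) := {s(x, y)}
  set K : Set (Sym2 V) := {e | e ∈ P2.edges}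
  have hIJ : Disjoint I J := Set.disjoint_left.mpr fun e h1 h2 =>
    hnd.2.2 e h1 e (by simp only [J, Set.mem_singleton_iff] at h2; simp [h2]) rfl
  have hIK : Disjoint I K := Set.disjoint_left.mpr fun e h1 h2 =>
    hnd.2.2 e h1 e (List.mem_cons_of_mem _ h2) rfl
  have hJK : Disjoint J K := Set.disjoint_left.mpr fun e h1 h2 => by
    simp only [J, Set.mem_singleton_iff] at h1; subst h1; exact hnd.2.1.1 h2
  refine ⟨x, y, hx, hy, O_le ω hxy, cfg I, cfg (J ∪ K), cfg_le ?_, cfg_le ?_,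
    cfg_disj (hIJ.union_right hIK), ?_,
    cfg J, cfg K, cfg_mono Set.subset_union_left, cfg_mono Set.subset_union_right,
    cfg_disj hJK, ?_, ?_⟩
  · intro e he; exact hsub (List.mem_append_left _ he)
  · rintro e (he | he)
    · simp only [J, Set.mem_singleton_iff] at he; subst he; exact hxy
    · exact P2.edges_subset_edgeSet he
  · exact CnS_cfg P1 (fun e he => he)
  · show (O _).Adj x y
    rw [O_adj]
    exact ⟨O_le ω hxy, by simp [cfg, J]⟩
  · exact Cn_cfg P2 (fun e he => he)

/-- Vertices joined to `g`. -/
def Clus (g : Set V) (ω : G.edgeSet → Bool) : Set V := {z | ∃ y ∈ g, Cn ω y z}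

/-- Edges touching `T`. -/
def Touch (G : SimpleGraph V) (T : Set V) : Set G.edgeSet := {e | ∃ a ∈ e.1, a ∈ T}

lemma subset_Clus (g : Set V) (ω : G.edgeSet → Bool) : g ⊆ Clus g ω :=
  fun y hy => ⟨y, hy, SimpleGraph.Reachable.refl _⟩

lemma Clus_closed {g : Set V} {ω : G.edgeSet → Bool} {x y : V} (h : x ∈ Clus g ω)
    (hxy : Cn ω x y) : y ∈ Clus g ω := by
  obtain ⟨z, hz, h⟩ := h
  exact ⟨z, hz, Cn_trans h hxy⟩

lemma O_adj_agree {ω ω' : G.edgeSet → Bool} {T : Set V} (hag : ∀ e ∈ Touch G T, ω e = ω' e)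
    {x y : V} (hx : x ∈ T) (h : (O ω).Adj x y) : (O ω').Adj x y := by
  rw [O_adj] at *
  obtain ⟨h1, h2⟩ := h
  refine ⟨h1, ?_⟩
  rw [← hag ⟨s(x,y), h1⟩ ⟨x, by simp, hx⟩]; exact h2

lemma Clus_agree {g T : Set V} {ω ω' : G.edgeSet → Bool}
    (hag : ∀ e ∈ Touch G T, ω e = ω' e) (h : Clus g ω = T) : Clus g ω' = T := by
  have hgT : g ⊆ T := h ▸ subset_Clus g ω
  have hcl : ∀ x y, x ∈ T → (O ω).Adj x y → y ∈ T := by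
    intro x y hx hxy
    subst h
    exact Clus_closed hx hxy.reachable
  have hag' : ∀ e ∈ Touch G T, ω' e = ω e := fun e he => (hag e he).symm
  apply Set.Subset.antisymm
  · rintro z ⟨y, hy, ⟨w⟩⟩
    have hyT := hgT hy
    clear hy
    induction w with
    | nil => exact hyT
    | cons hab q ih => exact ih (hcl _ _ hyT (O_adj_agree hag' hyT hab))
  · intro z hz
    rw [← h] at hz
    obtain ⟨y, hy, ⟨w⟩⟩ := hz
    refine ⟨y, hy, ?_⟩
    have hyT := hgT hy
    clear hy
    induction w with
    | nil => exact SimpleGraph.Reachable.refl _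
    | cons hab q ih =>
      exact (O_adj_agree hag hyT hab).reachable.trans (ih (hcl _ _ hyT hab))

lemma Clus_dep (g T : Set V) : DepOn (Touch G T) (fun ω => Clus g ω = T) := by
  intro ω ω' h
  exact propext ⟨Clus_agree h, Clus_agree fun e he => (h e he).symm⟩

lemma CnS_dep (T : Set V) (u z : V) : DepOn (Touch G T)ᶜ (fun ω => CnS Tᶜ ω u z) := by
  have key : ∀ ω ω' : G.edgeSet → Bool, (∀ i ∈ (Touch G T)ᶜ, ω i = ω' i) →
      OS ω Tᶜ ≤ OS ω' Tᶜ := by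
    intro ω ω' h x y hxy
    refine ⟨?_, hxy.2⟩
    have h1 := hxy.1
    rw [O_adj] at *
    obtain ⟨h2, h3⟩ := h1
    refine ⟨h2, ?_⟩
    rw [← h _ ?_]
    · exact h3
    · rintro ⟨a, ha, haT⟩
      simp only [Sym2.mem_iff] at ha
      rcases ha with rfl | rfl
      · exact hxy.2.1 haT
      · exact hxy.2.2 haT
  intro ω ω' h
  exact propext ⟨fun hc => hc.mono (key _ _ h), fun hc => hc.mono (key _ _ fun i hi => (h i hi).symm)⟩

lemma CnS_of_off {g T : Set V} {ω : G.edgeSet → Bool} (h : Clus g ω = T) {u z : V} (hu : u ∉ T)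
    (hc : Cn ω u z) : CnS Tᶜ ω u z := by
  obtain ⟨w⟩ := hc
  apply reach_OS w
  intro v hv hvT
  rw [← h] at hvT hu
  exact hu (Clus_closed hvT (Cn_symm ⟨w.takeUntil v hv⟩))

end PercProof
end

noncomputable section
open Classical
set_option linter.unusedSectionVars false

namespace PercProof
open Percolation

variable {V : Type} [Fintype V] [DecidableEq V] {G : SimpleGraph V}

/-- Two-point function. -/
def ta (G : SimpleGraph V) (p : ℝ) (x y : V) : ℝ :=
  Pr (fun _ : G.edgeSet => p) (fun ω => Cn ω x y)

/-- Restricted two-point function. -/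
def taS (G : SimpleGraph V) (p : ℝ) (S : Set V) (x y : V) : ℝ :=
  Pr (fun _ : G.edgeSet => p) (fun ω => CnS S ω x y)

/-- Law of the cluster of `g`. -/
def qC (G : SimpleGraph V) (p : ℝ) (g T : Set V) : ℝ :=
  Pr (fun _ : G.edgeSet => p) (fun ω => Clus g ω = T)

lemma ta_symm (p : ℝ) (x y : V) : ta G p x y = ta G p y x := by
  unfold ta
  congr 1; ext ω
  exact ⟨Cn_symm, Cn_symm⟩

lemma ta_self (p : ℝ) (x : V) : ta G p x x = 1 := by
  unfold ta Pr
  rw [← Ew_const (fun _ : G.edgeSet => p) 1]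
  congr 1; ext ω
  exact ind_true (SimpleGraph.Reachable.refl _)

lemma ta_nonneg {p : ℝ} (h0 : 0 ≤ p) (h1 : p ≤ 1) (x y : V) : 0 ≤ ta G p x y :=
  Pr_nonneg (fun _ => h0) (fun _ => h1) _

lemma taS_nonneg {p : ℝ} (h0 : 0 ≤ p) (h1 : p ≤ 1) (S : Set V) (x y : V) : 0 ≤ taS G p S x y :=
  Pr_nonneg (fun _ => h0) (fun _ => h1) _

lemma qC_nonneg {p : ℝ} (h0 : 0 ≤ p) (h1 : p ≤ 1) (g T : Set V) : 0 ≤ qC G p g T :=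
  Pr_nonneg (fun _ => h0) (fun _ => h1) _

lemma ind_monotone {ι : Type} {A : (ι → Bool) → Prop} (h : Monotone A) :
    Monotone (fun ω => ind (A ω)) := fun _ _ hh => ind_mono (h hh)

lemma ta_mono {p q : ℝ} (h0 : 0 ≤ p) (hpq : p ≤ q) (h1 : q ≤ 1) (x y : V) :
    ta G p x y ≤ ta G q x y :=
  E_mono_p (ind_monotone (Cn_mono x y)) h0 hpq h1

lemma tree_graph {p : ℝ} (h0 : 0 ≤ p) (h1 : p ≤ 1/2) (a u w : V) :
    Pr (fun _ : G.edgeSet => p) (fun ω => Cn ω a u ∧ Cn ω a w) ≤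
      ∑ z, ta G p a z * (ta G p z u * ta G p z w) := by
  refine (Pr_union_bound (fun _ => h0) (fun _ => by linarith) Finset.univ
    (B := fun z => Dj (fun ω => Cn ω a z) (Dj (fun ω => Cn ω z u) (fun ω => Cn ω z w))) ?_).trans ?_
  · rintro ω ⟨hu, hw⟩
    obtain ⟨z, hz⟩ := tree_det hu hw
    exact ⟨z, Finset.mem_univ _, hz⟩
  · exact Finset.sum_le_sum fun z _ => BK3 h0 h1 (Cn_mono a z) (Cn_mono z u) (Cn_mono z w)

lemma Pr_or {ι : Type} [Fintype ι] {P : ι → ℝ} (h0 : ∀ i, 0 ≤ P i) (h1 : ∀ i, P i ≤ 1)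
    {A B C : (ι → Bool) → Prop} (h : ∀ ω, A ω → B ω ∨ C ω) : Pr P A ≤ Pr P B + Pr P C := by
  unfold Pr
  rw [← Ew_add]
  refine Ew_mono h0 h1 fun ω => ?_
  by_cases hA : A ω
  · rcases h ω hA with hB | hC
    · rw [ind_true hA, ind_true hB]; linarith [ind_nonneg (C ω)]
    · rw [ind_true hA, ind_true hC]; linarith [ind_nonneg (B ω)]
  · rw [ind_false hA]; linarith [ind_nonneg (C ω), ind_nonneg (B ω)]

lemma sum_ind_mul {κ : Type*} [Fintype κ] (c : κ → Prop) (f : κ → ℝ) :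
    ∑ k, ind (c k) * f k = ∑ k ∈ Finset.univ.filter c, f k := by
  rw [Finset.sum_filter]
  refine Finset.sum_congr rfl fun k _ => ?_
  unfold ind; split_ifs <;> simp

lemma through_bound {p : ℝ} (h0 : 0 ≤ p) (h1 : p ≤ 1/2) (A : Set V) (v x : V) :
    ta G p v x ≤ taS G p Aᶜ v x + ∑ w, ind (w ∈ A) * (ta G p v w * ta G p w x) := by
  have q1 : p ≤ 1 := by linarith
  refine (Pr_or (fun _ => h0) (fun _ => q1) (B := fun ω => CnS Aᶜ ω v x)
    (C := fun ω => Cn ω v x ∧ ¬ CnS Aᶜ ω v x) (fun ω h => by tauto)).trans ?_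
  refine add_le_add le_rfl ?_
  rw [sum_ind_mul]
  refine (Pr_union_bound (fun _ => h0) (fun _ => q1) (Finset.univ.filter (· ∈ A))
    (B := fun w => Dj (fun ω => Cn ω v w) (fun ω => Cn ω w x)) ?_).trans ?_
  · rintro ω ⟨hu, hw⟩
    obtain ⟨w, hwA, hz⟩ := through_det hu hw
    exact ⟨w, by simpa using hwA, hz⟩
  · exact Finset.sum_le_sum fun z _ => BK h0 h1 (Cn_mono v z) (Cn_mono z x)

lemma Pr_Op {p : ℝ} {x y : V} (h : G.Adj x y) :
    Pr (fun _ : G.edgeSet => p) (Op x y) = p := by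
  have h2 := Pr_coord (fun _ : G.edgeSet => p) ⟨s(x, y), h⟩
  refine Eq.trans ?_ h2
  congr 1; ext ω
  unfold Op
  rw [O_adj]
  exact ⟨fun ⟨_, h⟩ => h, fun h' => ⟨h, h'⟩⟩

lemma exit_bound {p : ℝ} (h0 : 0 ≤ p) (h1 : p ≤ 1/2) {S : Set V} {a : V} (ha : a ∈ S) (z : V) :
    ta G p a z ≤ taS G p S a z +
      ∑ x, ∑ y, ind (x ∈ S ∧ y ∉ S ∧ G.Adj x y) * (taS G p S a x * (p * ta G p y z)) := by
  have q1 : p ≤ 1 := by linarith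
  refine (Pr_or (fun _ => h0) (fun _ => q1) (B := fun ω => CnS S ω a z)
    (C := fun ω => Cn ω a z ∧ ¬ CnS S ω a z) (fun ω h => by tauto)).trans ?_
  refine add_le_add le_rfl ?_
  rw [← Fintype.sum_prod_type' (f := fun x y =>
    ind (x ∈ S ∧ y ∉ S ∧ G.Adj x y) * (taS G p S a x * (p * ta G p y z))), sum_ind_mul]
  refine (Pr_union_bound (fun _ => h0) (fun _ => q1)
    (Finset.univ.filter (fun k : V × V => k.1 ∈ S ∧ k.2 ∉ S ∧ G.Adj k.1 k.2))
    (B := fun k => Dj (fun ω => CnS S ω a k.1) (Dj (Op k.1 k.2) (fun ω => Cn ω k.2 z))) ?_).trans ?_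
  · rintro ω ⟨hu, hw⟩
    obtain ⟨x, y, hx, hy, hxy, hd⟩ := exit_det ha hu hw
    exact ⟨(x, y), by simp [hx, hy, hxy], hd⟩
  · refine (Finset.sum_le_sum (g := fun k : V × V => taS G p S a k.1 * (p * ta G p k.2 z))
      fun k hk => ?_).trans (le_of_eq (Finset.sum_congr (by congr) fun _ _ => rfl))
    simp only [Finset.mem_filter, Finset.mem_univ, true_and] at hk
    have := BK3 h0 h1 (CnS_mono (G := G) S a k.1) (Op_mono (G := G) k.1 k.2) (Cn_mono (G := G) k.2 z)
    rw [Pr_Op hk.2.2] at this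
    exact this

lemma total_clus (p : ℝ) (g : Set V) (f : (G.edgeSet → Bool) → ℝ) :
    Ew (fun _ : G.edgeSet => p) f =
      ∑ T : Set V, Ew (fun _ : G.edgeSet => p) (fun ω => ind (Clus g ω = T) * f ω) := by
  rw [← Ew_sum]
  congr 1; ext ω
  rw [Finset.sum_eq_single (Clus g ω)]
  · rw [ind_true rfl, one_mul]
  · intro T _ hT; rw [ind_false (fun h => hT h.symm), zero_mul]
  · simp

lemma cond_clus (p : ℝ) (g : Set V) (c : Set V → Prop) (v x : V) :
    Pr (fun _ : G.edgeSet => p) (fun ω => c (Clus g ω) ∧ CnS (Clus g ω)ᶜ ω v x) =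
      ∑ T : Set V, ind (c T) * (qC G p g T * taS G p Tᶜ v x) := by
  unfold Pr
  rw [total_clus p g]
  refine Finset.sum_congr rfl fun T _ => ?_
  have := Pr_indep (P := fun _ : G.edgeSet => p) (Clus_dep g T) (CnS_dep T v x)
  unfold qC taS
  rw [← this, Pr, ← Ew_mul_left]
  congr 1; ext ω
  by_cases h : Clus g ω = T
  · simp only [h, ind_and]; ring
  · simp only [ind_and, ind_false h]; ring

lemma cond_clus' (p : ℝ) (g : Set V) (c : Set V → ℝ) :
    Ew (fun _ : G.edgeSet => p) (fun ω => c (Clus g ω)) =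
      ∑ T : Set V, c T * qC G p g T := by
  rw [total_clus p g]
  refine Finset.sum_congr rfl fun T _ => ?_
  unfold qC Pr
  rw [← Ew_mul_left]
  congr 1; ext ω
  by_cases h : Clus g ω = T
  · rw [ind_true h, h]; ring
  · rw [ind_false h]; ring

/-- Lower bound for the pivotal sum. -/
lemma pivotal_bound {p : ℝ} (h0 : 0 ≤ p) (h1 : p ≤ 1) {A : (G.edgeSet → Bool) → Prop}
    (mA : Monotone A) (B : V → V → (G.edgeSet → Bool) → Prop)
    (hB : ∀ u v ω, B u v ω → ∃ h : s(u, v) ∈ G.edgeSet,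
      A (up ω ⟨s(u, v), h⟩ true) ∧ ¬ A ω)
    (hanti : ∀ u v ω, B u v ω → ¬ B v u ω) :
    ∑ u, ∑ v, Pr (fun _ : G.edgeSet => p) (B u v) ≤
      (1 - p) * dE p (fun ω => ind (A ω)) := by
  have e1 : ∀ e : G.edgeSet, (1 - p) * E p (fun ω => ind (A (up ω e true)) -
        ind (A (up ω e false))) =
      E p (fun ω => ind (A (up ω e true)) - ind (A ω)) := by
    intro e
    have := Ew_split_up (fun _ : G.edgeSet => p) e
      (fun ω => ind (A (up ω e true)) - ind (A ω))
    simp only [up_up, sub_self, Ew_const, mul_zero, zero_add] at this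
    exact this.symm
  rw [dE, Finset.mul_sum]
  simp only [e1]
  unfold Pr E
  simp only [← Ew_sum]
  refine Ew_mono (fun _ => h0) (fun _ => h1) fun ω => ?_
  by_cases hA : A ω
  · have l : ∑ u, ∑ v, ind (B u v ω) = 0 := by
      refine Finset.sum_eq_zero fun u _ => Finset.sum_eq_zero fun v _ => ind_false ?_
      intro hb
      obtain ⟨_, _, h⟩ := hB u v ω hb
      exact h hA
    rw [l]
    refine Finset.sum_nonneg fun e _ => ?_
    rw [ind_true hA, ind_true (mA (le_up_true e ω) hA)]; simp
  · simp only [ind_false hA, sub_zero]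
    rw [← Fintype.sum_prod_type' (f := fun u v => ind (B u v ω))]
    unfold ind
    rw [Finset.sum_boole, Finset.sum_boole]
    norm_cast
    have hex : ∀ k : V × V, B k.1 k.2 ω → ∃ e : G.edgeSet, e.1 = s(k.1, k.2) ∧
        A (up ω e true) := by
      intro k hk
      obtain ⟨h, h', _⟩ := hB _ _ _ hk
      exact ⟨_, rfl, h'⟩
    by_cases hne : Nonempty G.edgeSet
    · have : ∀ k : V × V, ∃ e : G.edgeSet, B k.1 k.2 ω → e.1 = s(k.1, k.2) ∧
        A (up ω e true) := by
        intro k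
        by_cases hk : B k.1 k.2 ω
        · obtain ⟨e, he⟩ := hex k hk; exact ⟨e, fun _ => he⟩
        · exact ⟨hne.some, fun h => absurd h hk⟩
      choose f hf using this
      apply Finset.card_le_card_of_injOn f
      · intro k hk
        simp only [Finset.coe_filter, Finset.mem_univ, true_and, Set.mem_ofPred_eq] at hk ⊢
        exact (hf k hk).2
      · intro k hk l hl hkl
        simp only [Finset.coe_filter, Finset.mem_univ, true_and, Set.mem_ofPred_eq] at hk hl
        have h3 := (hf k hk).1
        rw [hkl, (hf l hl).1] at h3
        obtain ⟨k1, k2⟩ := k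
        obtain ⟨l1, l2⟩ := l
        simp only [Sym2.eq_iff] at h3
        rcases h3 with ⟨rfl, rfl⟩ | ⟨rfl, rfl⟩
        · rfl
        · exact absurd hk (hanti _ _ _ hl)
    · have : (Finset.univ.filter fun k : V × V => B k.1 k.2 ω) = ∅ := by
        rw [Finset.filter_eq_empty_iff]
        intro k _ hk
        obtain ⟨e, _⟩ := hex k hk
        exact hne ⟨e⟩
      rw [this]; simp

end PercProof
end

noncomputable section
open Classical
set_option linter.unusedSectionVars false

namespace PercProof
open Percolation

variable {V : Type} [Fintype V] [DecidableEq V] {G : SimpleGraph V}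

lemma Ew_equiv {ι : Type} [Fintype ι] (p : ℝ) (σ : ι ≃ ι) (f : (ι → Bool) → ℝ) :
    Ew (fun _ : ι => p) (fun ω => f (ω ∘ σ)) = Ew (fun _ : ι => p) f := by
  unfold Ew
  refine Eq.trans ?_ (Equiv.sum_comp (Equiv.arrowCongr σ.symm (Equiv.refl Bool))
    (fun ω => Wt (fun _ => p) ω * f ω))
  refine Finset.sum_congr rfl fun ω _ => ?_
  have : (Equiv.arrowCongr σ.symm (Equiv.refl Bool)) ω = ω ∘ σ := by
    ext i; simp
  rw [this]
  congr 1
  unfold Wt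
  exact (Equiv.prod_comp σ (fun i => bw p (ω i))).symm

lemma ta_inv (φ : G ≃g G) (p : ℝ) (x y : V) : ta G p (φ x) (φ y) = ta G p x y := by
  unfold ta Pr
  rw [← Ew_equiv p φ.mapEdgeSet (fun ω => ind (Cn ω x y))]
  congr 1; ext ω
  congr 1
  have h : ∀ u v, (O (ω ∘ φ.mapEdgeSet)).Adj u v ↔ (O ω).Adj (φ u) (φ v) := by
    intro u v
    rw [O_adj, O_adj]
    constructor
    · rintro ⟨h, h'⟩
      exact ⟨(φ.mapEdgeSet ⟨s(u, v), h⟩).2, h'⟩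
    · rintro ⟨h, h'⟩
      have h2 : s(u, v) ∈ G.edgeSet := by
        rw [SimpleGraph.mem_edgeSet] at *
        exact φ.map_adj_iff.mp h
      exact ⟨h2, h'⟩
  let ψ : O (ω ∘ φ.mapEdgeSet) ≃g O ω := ⟨φ.toEquiv, fun {u v} => (h u v).symm⟩
  have := ψ.reachable_iff (u := x) (v := y)
  exact propext this

/-- Susceptibility. -/
def ch (G : SimpleGraph V) (p : ℝ) (a : V) : ℝ := ∑ x, ta G p a x

lemma ch_const (hT : IsTransitive G) (p : ℝ) (v a : V) : ch G p v = ch G p a := by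
  obtain ⟨φ, rfl⟩ := hT a v
  unfold ch
  rw [← Equiv.sum_comp φ.toEquiv]
  exact Finset.sum_congr rfl fun x _ => ta_inv φ p a x

lemma ch_nonneg {p : ℝ} (h0 : 0 ≤ p) (h1 : p ≤ 1) (a : V) : 0 ≤ ch G p a :=
  Finset.sum_nonneg fun _ _ => ta_nonneg h0 h1 _ _

lemma ch_ge_one {p : ℝ} (h0 : 0 ≤ p) (h1 : p ≤ 1) (a : V) : 1 ≤ ch G p a := by
  rw [← ta_self (G := G) p a]
  exact Finset.single_le_sum (f := fun x => ta G p a x) (fun _ _ => ta_nonneg h0 h1 _ _)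
    (Finset.mem_univ a)

lemma ch_mono {p q : ℝ} (h0 : 0 ≤ p) (hpq : p ≤ q) (h1 : q ≤ 1) (a : V) :
    ch G p a ≤ ch G q a := Finset.sum_le_sum fun _ _ => ta_mono h0 hpq h1 _ _

/-- Auxiliary diagram. -/
def gd (G : SimpleGraph V) (p : ℝ) (z : V) : ℝ :=
  ∑ u, ∑ v, ind (G.Adj u v) * ∑ w, ta G p v w * (ta G p z u * ta G p z w)

lemma gd_const (hT : IsTransitive G) (p : ℝ) (v a : V) : gd G p v = gd G p a := by
  obtain ⟨φ, rfl⟩ := hT a v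
  unfold gd
  rw [← Equiv.sum_comp φ.toEquiv]
  refine Finset.sum_congr rfl fun x _ => ?_
  rw [← Equiv.sum_comp φ.toEquiv]
  refine Finset.sum_congr rfl fun y _ => ?_
  rw [← Equiv.sum_comp φ.toEquiv]
  have : G.Adj (φ.toEquiv x) (φ.toEquiv y) ↔ G.Adj x y := φ.map_adj_iff
  rw [this]
  congr 1
  refine Finset.sum_congr rfl fun w _ => ?_
  have e : ∀ a b, ta G p (φ.toEquiv a) (φ.toEquiv b) = ta G p a b := fun a b => ta_inv φ p a b
  have e2 : ∀ b, ta G p (φ a) (φ.toEquiv b) = ta G p a b := fun b => ta_inv φ p a b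
  rw [e, e2, e2]

lemma gd_le (hT : IsTransitive G) {Om : ℝ} (hreg : ∀ u, ∑ v, ind (G.Adj u v) = Om)
    {p c : ℝ} (htri : ∀ u v, G.Adj u v → ∑ z, ∑ w, ta G p u z * ta G p z w * ta G p w v ≤ c)
    (a : V) : gd G p a ≤ Om * c := by
  have h1 : ∑ z, gd G p z ≤ (Fintype.card V) * (Om * c) := by
    have e1 : ∑ z, gd G p z = ∑ u, ∑ v, ind (G.Adj u v) *
        ∑ z, ∑ w, ta G p u z * ta G p z w * ta G p w v := by
      unfold gd
      rw [Finset.sum_comm]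
      refine Finset.sum_congr rfl fun u _ => ?_
      rw [Finset.sum_comm]
      refine Finset.sum_congr rfl fun v _ => ?_
      rw [Finset.mul_sum]
      refine Finset.sum_congr rfl fun z _ => ?_
      congr 1
      refine Finset.sum_congr rfl fun w _ => ?_
      rw [ta_symm p v w, ta_symm p z u]; ring
    rw [e1]
    have : ∀ u, ∑ v, ind (G.Adj u v) * ∑ z, ∑ w, ta G p u z * ta G p z w * ta G p w v ≤ Om * c := by
      intro u
      rw [← hreg u, Finset.sum_mul]
      refine Finset.sum_le_sum fun v _ => ?_
      by_cases h : G.Adj u v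
      · rw [ind_true h]; linarith [htri u v h]
      · rw [ind_false h]; simp
    refine (Finset.sum_le_sum fun u _ => this u).trans ?_
    rw [Finset.sum_const, nsmul_eq_mul, Finset.card_univ]
  have h2 : ∑ z, gd G p z = (Fintype.card V) * gd G p a := by
    rw [Finset.sum_congr rfl fun z _ => gd_const hT p z a, Finset.sum_const, nsmul_eq_mul,
      Finset.card_univ]
  rw [h2] at h1
  have : (0:ℝ) < Fintype.card V := by exact_mod_cast Fintype.card_pos_iff.mpr ⟨a⟩
  exact le_of_mul_le_mul_left h1 this

lemma mem_Clus_single {a x : V} {ω : G.edgeSet → Bool} : x ∈ Clus {a} ω ↔ Cn ω a x := by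
  unfold Clus; simp

lemma Cn_up {ω : G.edgeSet → Bool} {a u v x : V} (h : s(u, v) ∈ G.edgeSet) (h1 : Cn ω a u)
    (h2 : Cn ω v x) : Cn (up ω ⟨s(u, v), h⟩ true) a x := by
  have l := le_up_true (⟨s(u, v), h⟩ : G.edgeSet) ω
  refine Cn_trans (Cn_mono a u l h1) (Cn_trans ?_ (Cn_mono v x l h2))
  refine SimpleGraph.Adj.reachable ?_
  rw [O_adj]
  exact ⟨h, up_same _ _ _⟩

lemma an_piv {p : ℝ} (h0 : 0 ≤ p) (h1 : p ≤ 1/2) (a x : V) :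
    ∑ u, ∑ v, ∑ T : Set V, ind (G.Adj u v ∧ u ∈ T ∧ v ∉ T) * (qC G p {a} T * taS G p Tᶜ v x) ≤
      (1 - p) * dE p (fun ω : G.edgeSet → Bool => ind (Cn ω a x)) := by
  have := pivotal_bound (p := p) h0 (by linarith) (Cn_mono (G := G) a x)
    (fun u v ω => (G.Adj u v ∧ u ∈ Clus {a} ω ∧ v ∉ Clus {a} ω) ∧ CnS (Clus {a} ω)ᶜ ω v x) ?_ ?_
  · refine le_trans (le_of_eq ?_) this
    refine Finset.sum_congr rfl fun u _ => Finset.sum_congr rfl fun v _ => ?_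
    exact (cond_clus p {a} (fun T => G.Adj u v ∧ u ∈ T ∧ v ∉ T) v x).symm
  · rintro u v ω ⟨⟨hadj, hu, hv⟩, hc⟩
    refine ⟨hadj, Cn_up _ (mem_Clus_single.mp hu) (CnS_Cn hc), fun h => hv ?_⟩
    exact Clus_closed (mem_Clus_single.mpr h) (Cn_symm (CnS_Cn hc))
  · rintro u v ω ⟨⟨_, hu, hv⟩, _⟩ ⟨⟨_, hu', hv'⟩, _⟩
    exact hv hu'

lemma sum_qC (p : ℝ) (a : V) (c : Set V → Prop) :
    ∑ T : Set V, ind (c T) * qC G p {a} T =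
      Pr (fun _ : G.edgeSet => p) (fun ω => c (Clus {a} ω)) := by
  rw [← cond_clus' p {a} (fun T => ind (c T))]; rfl

/-- The Aizenman-Newman differential inequality. -/
lemma an_ineq (hT : IsTransitive G) {Om : ℝ} (hreg : ∀ u, ∑ v, ind (G.Adj u v) = Om)
    {p c : ℝ} (h0 : 0 ≤ p) (h1 : p ≤ 1/2)
    (htri : ∀ u v, G.Adj u v → ∑ z, ∑ w, ta G p u z * ta G p z w * ta G p w v ≤ c) (a : V) :
    Om * (1 - c) * ch G p a ^ 2 ≤
      (1 - p) * ∑ x, dE p (fun ω : G.edgeSet → Bool => ind (Cn ω a x)) := by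
  have q1 : p ≤ 1 := by linarith
  set X := ch G p a with hX
  have X0 : 0 ≤ X := ch_nonneg h0 q1 a
  have s1 : ∀ (T : Set V) (v : V), X * (1 - ∑ w, ind (w ∈ T) * ta G p v w) ≤
      ∑ x, taS G p Tᶜ v x := by
    intro T v
    have t1 := Finset.sum_le_sum fun x (_ : x ∈ Finset.univ) =>
      through_bound (G := G) h0 h1 T v x
    rw [Finset.sum_add_distrib, Finset.sum_comm (f := fun x w => ind (w ∈ T) *
      (ta G p v w * ta G p w x))] at t1
    have t2 : ∀ w, ∑ x, ind (w ∈ T) * (ta G p v w * ta G p w x) = ind (w ∈ T) * ta G p v w * X := by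
      intro w
      rw [hX, ← ch_const hT p w a, ch, Finset.mul_sum]
      exact Finset.sum_congr rfl fun _ _ => by ring
    simp only [t2] at t1
    rw [← Finset.sum_mul] at t1
    have t3 : ∑ x, ta G p v x = X := ch_const hT p v a
    rw [t3] at t1
    linarith
  have s2 : ∀ u v, ind (G.Adj u v) * (X * (ta G p a u -
        ∑ z, ta G p a z * ∑ w, ta G p v w * (ta G p z u * ta G p z w))) ≤
      ∑ x, ∑ T : Set V, ind (G.Adj u v ∧ u ∈ T ∧ v ∉ T) * (qC G p {a} T * taS G p Tᶜ v x) := by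
    intro u v
    rw [Finset.sum_comm]
    have t1 : ∀ T : Set V, ind (G.Adj u v) * (X * (ind (u ∈ T) * qC G p {a} T -
        ∑ w, ta G p v w * (ind (u ∈ T ∧ w ∈ T) * qC G p {a} T))) ≤
        ∑ x, ind (G.Adj u v ∧ u ∈ T ∧ v ∉ T) * (qC G p {a} T * taS G p Tᶜ v x) := by
      intro T
      have l : ind (G.Adj u v) * (X * (ind (u ∈ T) * qC G p {a} T -
          ∑ w, ta G p v w * (ind (u ∈ T ∧ w ∈ T) * qC G p {a} T))) =
          ind (G.Adj u v) * ind (u ∈ T) * qC G p {a} T *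
            (X * (1 - ∑ w, ind (w ∈ T) * ta G p v w)) := by
        have : ∑ w, ta G p v w * (ind (u ∈ T ∧ w ∈ T) * qC G p {a} T) =
          ind (u ∈ T) * qC G p {a} T * ∑ w, ind (w ∈ T) * ta G p v w := by
          rw [Finset.mul_sum]
          exact Finset.sum_congr rfl fun w _ => by rw [ind_and]; ring
        rw [this]; ring
      rw [l]
      have r : ∑ x, ind (G.Adj u v ∧ u ∈ T ∧ v ∉ T) * (qC G p {a} T * taS G p Tᶜ v x) =
          ind (G.Adj u v) * ind (u ∈ T) * qC G p {a} T * (ind (v ∉ T) * ∑ x, taS G p Tᶜ v x) := by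
        rw [Finset.mul_sum, Finset.mul_sum]
        exact Finset.sum_congr rfl fun x _ => by rw [ind_and, ind_and]; ring
      rw [r]
      refine mul_le_mul_of_nonneg_left ?_ (mul_nonneg (mul_nonneg (ind_nonneg _) (ind_nonneg _))
        (qC_nonneg h0 q1 _ _))
      by_cases hv : v ∈ T
      · rw [ind_false (not_not.mpr hv), zero_mul]
        refine mul_nonpos_of_nonneg_of_nonpos X0 ?_
        have := Finset.single_le_sum (f := fun w => ind (w ∈ T) * ta G p v w)
          (fun w _ => mul_nonneg (ind_nonneg _) (ta_nonneg h0 q1 _ _)) (Finset.mem_univ v)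
        simp only [ind_true hv, ta_self] at this
        linarith
      · rw [ind_true hv, one_mul]; exact s1 T v
    refine le_trans ?_ (Finset.sum_le_sum fun T _ => t1 T)
    rw [← Finset.mul_sum, ← Finset.mul_sum, Finset.sum_sub_distrib, sum_qC p a (fun T => u ∈ T),
      Finset.sum_comm]
    simp only [← Finset.mul_sum]
    refine mul_le_mul_of_nonneg_left (mul_le_mul_of_nonneg_left ?_ X0) (ind_nonneg _)
    have k1 : Pr (fun _ : G.edgeSet => p) (fun ω => u ∈ Clus {a} ω) = ta G p a u := by
      unfold ta; simp only [mem_Clus_single]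
    rw [k1]
    refine sub_le_sub le_rfl ?_
    have k2 : ∑ z, ta G p a z * ∑ w, ta G p v w * (ta G p z u * ta G p z w) =
        ∑ w, ta G p v w * ∑ z, ta G p a z * (ta G p z u * ta G p z w) := by
      simp only [Finset.mul_sum]
      rw [Finset.sum_comm]
      exact Finset.sum_congr rfl fun _ _ => Finset.sum_congr rfl fun _ _ => by ring
    rw [k2]
    refine Finset.sum_le_sum fun w _ => mul_le_mul_of_nonneg_left ?_ (ta_nonneg h0 q1 _ _)
    rw [sum_qC p a (fun T => u ∈ T ∧ w ∈ T)]
    simp only [mem_Clus_single]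
    exact tree_graph h0 h1 a u w
  rw [Finset.mul_sum]
  refine le_trans ?_ (Finset.sum_le_sum fun x _ => an_piv h0 h1 a x)
  have s3 : ∑ x, ∑ u, ∑ v, ∑ T : Set V,
      ind (G.Adj u v ∧ u ∈ T ∧ v ∉ T) * (qC G p {a} T * taS G p Tᶜ v x) =
      ∑ u, ∑ v, ∑ x, ∑ T : Set V,
      ind (G.Adj u v ∧ u ∈ T ∧ v ∉ T) * (qC G p {a} T * taS G p Tᶜ v x) := by
    rw [Finset.sum_comm]
    exact Finset.sum_congr rfl fun u _ => Finset.sum_comm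
  rw [s3]
  refine le_trans ?_ (Finset.sum_le_sum fun u _ => Finset.sum_le_sum fun v _ => s2 u v)
  have s4 : ∑ u, ∑ v, ind (G.Adj u v) * (X * (ta G p a u -
        ∑ z, ta G p a z * ∑ w, ta G p v w * (ta G p z u * ta G p z w))) =
      X * (Om * X - ∑ z, ta G p a z * gd G p z) := by
    have t1 : ∑ u, ∑ v, ind (G.Adj u v) * ta G p a u = Om * X := by
      simp only [← Finset.sum_mul, hreg]
      rw [← Finset.mul_sum]; rfl
    have t2 : ∑ z, ta G p a z * gd G p z = ∑ u, ∑ v, ind (G.Adj u v) *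
        ∑ z, ta G p a z * ∑ w, ta G p v w * (ta G p z u * ta G p z w) := by
      unfold gd
      simp only [Finset.mul_sum]
      rw [Finset.sum_comm]
      refine Finset.sum_congr rfl fun u _ => ?_
      rw [Finset.sum_comm]
      refine Finset.sum_congr rfl fun v _ => Finset.sum_congr rfl fun z _ =>
        Finset.sum_congr rfl fun w _ => by ring
    rw [t2, ← t1, ← Finset.sum_sub_distrib, Finset.mul_sum]
    refine Finset.sum_congr rfl fun u _ => ?_
    rw [← Finset.sum_sub_distrib, Finset.mul_sum]
    exact Finset.sum_congr rfl fun v _ => by ring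
  rw [s4]
  have s5 : ∑ z, ta G p a z * gd G p z ≤ X * (Om * c) := by
    rw [hX, ch, Finset.sum_mul]
    exact Finset.sum_le_sum fun z _ => mul_le_mul_of_nonneg_left (gd_le hT hreg htri z)
      (ta_nonneg h0 q1 _ _)
  nlinarith [mul_le_mul_of_nonneg_left s5 X0]

lemma ch_deriv (p : ℝ) (a : V) : HasDerivAt (fun p => ch G p a)
    (∑ x, dE p (fun ω : G.edgeSet → Bool => ind (Cn ω a x))) p := by
  unfold ch ta Pr
  exact HasDerivAt.fun_sum fun x _ => russo_up _ _

/-- Integrated form. -/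
lemma an_int (hT : IsTransitive G) {Om : ℝ} (hOm : 0 ≤ Om) (hreg : ∀ u, ∑ v, ind (G.Adj u v) = Om)
    {pc c : ℝ} (hc : c ≤ 1) (h1 : pc ≤ 1/2)
    (htri : ∀ u v, G.Adj u v → ∑ z, ∑ w, ta G pc u z * ta G pc z w * ta G pc w v ≤ c) (a : V)
    {q : ℝ} (q0 : 0 ≤ q) (hq : q ≤ pc) :
    Om * (1 - c) * (pc - q) ≤ (ch G q a)⁻¹ - (ch G pc a)⁻¹ := by
  have hd : ∀ x, 0 ≤ x → x ≤ 1 → HasDerivAt (fun p => -(ch G p a)⁻¹ - Om * (1 - c) * p)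
      (-(-(∑ x_1, dE x (fun ω : G.edgeSet → Bool => ind (Cn ω a x_1))) / ch G x a ^ 2) -
        Om * (1 - c) * 1) x := by
    intro x hx hx1
    refine HasDerivAt.sub (HasDerivAt.neg (HasDerivAt.fun_inv (ch_deriv x a) ?_)) ((hasDerivAt_id x).const_mul _)
    linarith [ch_ge_one (G := G) hx hx1 a]
  have hm : MonotoneOn (fun p => -(ch G p a)⁻¹ - Om * (1 - c) * p) (Set.Icc q pc) := by
    apply monotoneOn_of_deriv_nonneg (convex_Icc q pc)
    · exact fun x hx => (hd x (by linarith [hx.1]) (by linarith [hx.2])).continuousAt.continuousWithinAt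
    · intro x hx
      have hx := interior_subset hx
      exact (hd x (by linarith [hx.1]) (by linarith [hx.2])).differentiableAt.differentiableWithinAt
    · intro x hx
      have hx := interior_subset hx
      have x0 : 0 ≤ x := by linarith [hx.1]
      rw [(hd x x0 (by linarith [hx.2])).deriv]
      have g1 := ch_ge_one (G := G) x0 (by linarith [hx.2]) a
      have := an_ineq hT hreg x0 (hx.2.trans h1) (c := c) (fun u v huv => by
        refine le_trans ?_ (htri u v huv)
        have m : ∀ s t, ta G x s t ≤ ta G pc s t := ta_mono x0 hx.2 (by linarith)
        have n : ∀ s t, 0 ≤ ta G x s t := ta_nonneg x0 (by linarith [hx.2])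
        refine Finset.sum_le_sum fun z _ => Finset.sum_le_sum fun w _ => ?_
        exact mul_le_mul (mul_le_mul (m _ _) (m _ _) (n _ _) ((n _ _).trans (m _ _))) (m _ _) (n _ _)
          (mul_nonneg ((n _ _).trans (m _ _)) ((n _ _).trans (m _ _)))) a
      set D := ∑ x_1, dE x (fun ω : G.edgeSet → Bool => ind (Cn ω a x_1)) with hD
      have L0 : 0 ≤ Om * (1 - c) * ch G x a ^ 2 :=
        mul_nonneg (mul_nonneg hOm (by linarith)) (sq_nonneg _)
      have D0 : 0 ≤ D := by
        by_contra h
        have : (1 - x) * D < 0 := mul_neg_of_pos_of_neg (by linarith [hx.2]) (by linarith)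
        linarith
      have : Om * (1 - c) * ch G x a ^ 2 ≤ D := by nlinarith
      have h2 : Om * (1 - c) ≤ D / ch G x a ^ 2 := by
        rw [le_div_iff₀ (by positivity)]; exact this
      rw [neg_div]; linarith
  have := hm ⟨le_rfl, hq⟩ ⟨hq, le_rfl⟩ hq
  simp only at this
  linarith

end PercProof
end

noncomputable section
open Classical
set_option linter.unusedSectionVars false

namespace PercProof
open Percolation

variable {V : Type} [Fintype V] [DecidableEq V] {G : SimpleGraph V}

/-- Likelihood ratio on `Touch T`. -/
def LR (q p : ℝ) (T : Set V) (ω : G.edgeSet → Bool) : ℝ :=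
  ∏ e, if e ∈ Touch G T then bw p (ω e) / bw q (ω e) else 1

lemma bw_pos {p : ℝ} (h0 : 0 < p) (h1 : p < 1) (b : Bool) : 0 < bw p b := by
  unfold bw; split_ifs <;> linarith

lemma LR_pos {q p : ℝ} (q0 : 0 < q) (q1 : q < 1) (p0 : 0 < p) (p1 : p < 1) (T : Set V)
    (ω : G.edgeSet → Bool) : 0 < LR q p T ω := by
  unfold LR
  refine Finset.prod_pos fun e _ => ?_
  split_ifs
  · exact div_pos (bw_pos p0 p1 _) (bw_pos q0 q1 _)
  · norm_num

lemma LR_change {q p : ℝ} (q0 : 0 < q) (q1 : q < 1) (a : V) (F : Set V → ℝ) :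
    E q (fun ω : G.edgeSet → Bool => F (Clus {a} ω) * LR q p (Clus {a} ω) ω) =
      E p (fun ω : G.edgeSet → Bool => F (Clus {a} ω)) := by
  unfold E
  rw [total_clus q {a}, total_clus p {a}]
  refine Finset.sum_congr rfl fun T _ => ?_
  have e1 : Ew (fun _ : G.edgeSet => p) (fun ω => ind (Clus {a} ω = T) * F (Clus {a} ω)) =
      Ew (fun e : G.edgeSet => if e ∈ Touch G T then p else q)
        (fun ω => ind (Clus {a} ω = T) * F (Clus {a} ω)) := by
    refine Ew_congr_dep (s := Touch G T) ?_ ?_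
    · intro i hi; simp [hi]
    · intro ω ω' h
      have h2 := Clus_dep {a} T ω ω' h
      simp only at h2
      by_cases h3 : Clus {a} ω = T
      · have h4 : Clus {a} ω' = T := h2 ▸ h3
        simp only [h3, h4]
      · have h4 : ¬ Clus {a} ω' = T := h2 ▸ h3
        simp only [ind_false h3, ind_false h4, zero_mul]
  rw [e1]
  unfold Ew
  refine Finset.sum_congr rfl fun ω _ => ?_
  by_cases h : Clus {a} ω = T
  · simp only [h]
    have : Wt (fun e : G.edgeSet => if e ∈ Touch G T then p else q) ω =
        Wt (fun _ : G.edgeSet => q) ω * LR q p T ω := by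
      unfold Wt LR
      rw [← Finset.prod_mul_distrib]
      refine Finset.prod_congr rfl fun e _ => ?_
      have := (bw_pos q0 q1 (ω e)).ne'
      by_cases he : e ∈ Touch G T
      · simp only [he, if_true]; field_simp
      · simp only [he, if_false, mul_one]
    rw [this]; ring
  · simp only [ind_false h]; ring

lemma touch_up {a : V} (e : G.edgeSet) (b : Bool) (ω : G.edgeSet → Bool) :
    e ∈ Touch G (Clus {a} (up ω e b)) ↔ e ∈ Touch G (Clus {a} ω) := by
  rw [← not_iff_not]
  constructor
  · intro h
    have : Clus {a} ω = Clus {a} (up ω e b) := by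
      refine Clus_agree (ω := up ω e b) ?_ rfl
      intro i hi
      refine up_ne _ ?_ _
      rintro rfl; exact h hi
    rwa [this]
  · intro h
    have : Clus {a} (up ω e b) = Clus {a} ω := by
      refine Clus_agree (ω := ω) ?_ rfl
      intro i hi
      refine (up_ne _ ?_ _).symm
      rintro rfl; exact h hi
    rwa [this]

lemma sum_ind_card {κ : Type} [Fintype κ] (c : κ → Prop) :
    ∑ k, ind (c k) = ((Finset.univ.filter c).card : ℝ) := by
  unfold ind
  rw [Finset.sum_boole]

lemma touch_count {Om : ℝ} (hreg : ∀ u, ∑ v, ind (G.Adj u v) = Om) (T : Set V) :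
    ∑ e : G.edgeSet, ind (e ∈ Touch G T) ≤ Om * ∑ y, ind (y ∈ T) := by
  have h1 : Om * ∑ y, ind (y ∈ T) = ∑ k : V × V, ind (G.Adj k.1 k.2 ∧ k.1 ∈ T) := by
    rw [Fintype.sum_prod_type' (f := fun u v => ind (G.Adj u v ∧ u ∈ T)), Finset.mul_sum]
    refine Finset.sum_congr rfl fun u _ => ?_
    rw [← hreg u, Finset.sum_mul]
    exact Finset.sum_congr rfl fun v _ => (ind_and _ _).symm
  rw [h1, sum_ind_card, sum_ind_card (fun k : V × V => G.Adj k.1 k.2 ∧ k.1 ∈ T)]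
  norm_cast
  have : ∀ e : G.edgeSet, ∃ k : V × V, e ∈ Touch G T → e.1 = s(k.1, k.2) ∧ k.1 ∈ T := by
    rintro ⟨e, he⟩
    by_cases h : (⟨e, he⟩ : G.edgeSet) ∈ Touch G T
    · obtain ⟨u, hu, huT⟩ := h
      obtain ⟨v, hv⟩ := Sym2.mem_iff_exists.mp hu
      exact ⟨(u, v), fun _ => ⟨hv, huT⟩⟩
    · induction e with
      | _ u v => exact ⟨(u, v), fun h' => absurd h' h⟩
  choose f hf using this
  apply Finset.card_le_card_of_injOn f
  · intro e he
    simp only [Finset.coe_filter, Finset.mem_univ, true_and, Set.mem_ofPred_eq] at he ⊢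
    obtain ⟨h1, h2⟩ := hf e he
    refine ⟨?_, h2⟩
    have := e.2
    rw [h1] at this
    exact this
  · intro e he e' he' hee
    simp only [Finset.coe_filter, Finset.mem_univ, true_and, Set.mem_ofPred_eq] at he he'
    apply Subtype.ext
    rw [(hf e he).1, (hf e' he').1, hee]

lemma kl_one {q p : ℝ} (q0 : 0 < q) (q1 : q < 1) (p0 : 0 < p) (p1 : p < 1) :
    q * Real.log (q / p) + (1 - q) * Real.log ((1 - q) / (1 - p)) ≤ (p - q) ^ 2 / (p * (1 - p)) := by
  have r1 : 0 < 1 - q := by linarith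
  have r2 : 0 < 1 - p := by linarith
  have a1 := Real.log_le_sub_one_of_pos (div_pos q0 p0)
  have a2 := Real.log_le_sub_one_of_pos (div_pos r1 r2)
  have : (p - q) ^ 2 / (p * (1 - p)) = q * (q / p - 1) + (1 - q) * ((1 - q) / (1 - p) - 1) := by
    field_simp; ring
  rw [this]
  exact add_le_add (mul_le_mul_of_nonneg_left a1 q0.le) (mul_le_mul_of_nonneg_left a2 r1.le)

lemma sum_Cn (p : ℝ) (a : V) :
    E p (fun ω : G.edgeSet → Bool => ∑ y, ind (Cn ω a y)) = ch G p a := by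
  unfold E ch ta Pr
  rw [Ew_sum]

lemma kl_bound {Om : ℝ} (hreg : ∀ u, ∑ v, ind (G.Adj u v) = Om)
    {q p : ℝ} (q0 : 0 < q) (q1 : q < 1) (p0 : 0 < p) (p1 : p < 1) (a : V) :
    E q (fun ω : G.edgeSet → Bool => - Real.log (LR q p (Clus {a} ω) ω)) ≤
      (p - q) ^ 2 / (p * (1 - p)) * (Om * ch G q a) := by
  have r1 : 0 < 1 - q := by linarith
  have r2 : 0 < 1 - p := by linarith
  have e1 : ∀ ω : G.edgeSet → Bool, - Real.log (LR q p (Clus {a} ω) ω) =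
      ∑ e, ind (e ∈ Touch G (Clus {a} ω)) * Real.log (bw q (ω e) / bw p (ω e)) := by
    intro ω
    unfold LR
    rw [Real.log_prod, ← Finset.sum_neg_distrib]
    · refine Finset.sum_congr rfl fun e _ => ?_
      split_ifs with h
      · rw [ind_true h, one_mul, ← Real.log_inv, inv_div]
      · rw [ind_false h]; simp
    · intro e _
      split_ifs
      · exact (div_pos (bw_pos p0 p1 _) (bw_pos q0 q1 _)).ne'
      · norm_num
  simp only [e1]
  unfold E
  rw [Ew_sum]
  have e2 : ∀ e : G.edgeSet, Ew (fun _ : G.edgeSet => q) (fun ω => ind (e ∈ Touch G (Clus {a} ω)) *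
      Real.log (bw q (ω e) / bw p (ω e))) =
      Ew (fun _ : G.edgeSet => q) (fun ω => ind (e ∈ Touch G (Clus {a} ω))) *
      (q * Real.log (q / p) + (1 - q) * Real.log ((1 - q) / (1 - p))) := by
    intro e
    rw [Ew_split_up _ e]
    simp only [touch_up, up_same, Ew_mul_right]
    simp only [bw]
    simp
    ring
  simp only [e2]
  rw [← Finset.sum_mul, ← Ew_sum, mul_comm]
  have b1 : Ew (fun _ : G.edgeSet => q) (fun ω => ∑ e, ind (e ∈ Touch G (Clus {a} ω))) ≤
      Om * ch G q a := by
    rw [← sum_Cn, ← Ew_mul_left]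
    refine Ew_mono (fun _ => q0.le) (fun _ => q1.le) fun ω => ?_
    have := touch_count hreg (Clus {a} ω)
    simpa only [mem_Clus_single] using this
  have b0 : 0 ≤ Ew (fun _ : G.edgeSet => q) (fun ω => ∑ e, ind (e ∈ Touch G (Clus {a} ω))) :=
    Ew_nonneg (fun _ => q0.le) (fun _ => q1.le) fun ω => Finset.sum_nonneg fun _ _ => ind_nonneg _
  exact mul_le_mul (kl_one q0 q1 p0 p1) b1 b0 (by positivity)

lemma exp_half {f : ℝ} (f0 : 0 ≤ f) (f1 : f ≤ 1) : Real.exp (-f) ≤ 1 - f / 2 := by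
  rw [Real.exp_neg]
  have h := Real.add_one_le_exp f
  have : (Real.exp f)⁻¹ ≤ (f + 1)⁻¹ := inv_anti₀ (by linarith) h
  refine this.trans ?_
  rw [inv_le_iff_one_le_mul₀ (by linarith)]
  nlinarith

lemma kl_point {f L : ℝ} (f0 : 0 ≤ f) (f1 : f ≤ 1) (hL : 0 < L) :
    f * L ≤ 2 * (- Real.log L + f + (L - 1)) := by
  have h1 := Real.log_le_sub_one_of_pos (mul_pos hL (Real.exp_pos (-f)))
  rw [Real.log_mul hL.ne' (Real.exp_pos _).ne', Real.log_exp] at h1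
  have := mul_le_mul_of_nonneg_left (exp_half f0 f1) hL.le
  nlinarith

lemma kl_main {Om : ℝ} (hreg : ∀ u, ∑ v, ind (G.Adj u v) = Om)
    {q p : ℝ} (q0 : 0 < q) (q1 : q < 1) (p0 : 0 < p) (p1 : p < 1) (a : V)
    (F : Set V → ℝ) (F0 : ∀ T, 0 ≤ F T) (F1 : ∀ T, F T ≤ 1) :
    E p (fun ω : G.edgeSet → Bool => F (Clus {a} ω)) ≤
      2 * ((p - q) ^ 2 / (p * (1 - p)) * (Om * ch G q a) +
        E q (fun ω : G.edgeSet → Bool => F (Clus {a} ω))) := by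
  have h1 := LR_change (G := G) (p := p) q0 q1 a (fun _ => 1)
  unfold E at h1
  rw [Ew_const] at h1
  simp only [one_mul] at h1
  rw [← LR_change q0 q1 a F]
  have := kl_bound (G := G) hreg q0 q1 p0 p1 a
  refine (Ew_mono (fun _ => q0.le) (fun _ => q1.le) fun ω =>
    kl_point (F0 (Clus {a} ω)) (F1 _) (LR_pos q0 q1 p0 p1 (Clus {a} ω) ω)).trans ?_
  rw [Ew_mul_left, Ew_add, Ew_add, Ew_sub, Ew_const, h1]
  unfold E at *
  linarith

/-- Upper bound on truncated expectation. -/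
lemma upper (hT : IsTransitive G) {Om : ℝ} (hOm : 99 ≤ Om) (hreg : ∀ u, ∑ v, ind (G.Adj u v) = Om)
    {pc : ℝ} (hpc : pc ≤ 1/100) (hpO : 99/100 ≤ pc * Om)
    (htri : ∀ u v, G.Adj u v → ∑ z, ∑ w, ta G pc u z * ta G pc z w * ta G pc w v ≤ 1/100) (a : V)
    {ε p N : ℝ} (hε : 0 < ε) (hp : p = pc + ε * Om⁻¹) (p1 : p ≤ 1) (hN : (ε ^ 2)⁻¹ ≤ N) :
    E p (fun ω : G.edgeSet → Bool => min ((∑ y, ind (Cn ω a y)) / N) 1) ≤ 27 * ε := by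
  have Om0 : 0 < Om := by linarith
  have pc0 : 0 < pc := by
    by_contra h
    nlinarith
  have hinv : 0 < ε * Om⁻¹ := by positivity
  by_cases h27 : 1/27 ≤ ε
  · have : E p (fun ω : G.edgeSet → Bool => min ((∑ y, ind (Cn ω a y)) / N) 1) ≤
        E p (fun _ : G.edgeSet → Bool => 1) :=
      Ew_mono (fun _ => by linarith) (fun _ => p1) fun ω => min_le_right _ _
    unfold E at *
    rw [Ew_const] at this
    linarith
  push Not at h27
  have hO : Om * (ε * Om⁻¹) = ε := by field_simp
  have hsm : ε * Om⁻¹ ≤ 1/2000 := by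
    rw [← div_eq_mul_inv, div_le_iff₀ Om0]; linarith
  set q := pc - ε * Om⁻¹ with hq
  have q0 : 0 < q := by
    have : 0 < q * Om := by
      rw [hq, sub_mul, mul_comm (ε * Om⁻¹), hO]; linarith
    exact pos_of_mul_pos_left this Om0.le
  have q1 : q < 1 := by linarith
  have p0 : 0 < p := by linarith
  have p1' : p ≤ 11/1000 := by linarith
  have X1 := ch_ge_one (G := G) q0.le q1.le a
  have hX : ch G q a ≤ 100 / (99 * ε) := by
    have := an_int (G := G) hT Om0.le hreg (c := 1/100) (by norm_num) (by linarith) htri a q0.le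
      (by linarith)
    have e1 : pc - q = ε * Om⁻¹ := by rw [hq]; ring
    rw [e1] at this
    have Y := ch_ge_one (G := G) pc0.le (by linarith) a
    have Y' : 0 < (ch G pc a)⁻¹ := by positivity
    have : 99/100 * ε ≤ (ch G q a)⁻¹ := by nlinarith
    rw [le_inv_comm₀ (by positivity) (by positivity)] at this
    refine this.trans (le_of_eq ?_)
    field_simp
  have hNp : 0 < N := lt_of_lt_of_le (by positivity) hN
  have key := kl_main (G := G) hreg q0 q1 p0 (by linarith) a
    (fun T => min ((∑ y, ind (y ∈ T)) / N) 1)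
    (fun T => le_min (div_nonneg (Finset.sum_nonneg fun _ _ => ind_nonneg _) hNp.le) zero_le_one)
    (fun T => min_le_right _ _)
  simp only [mem_Clus_single] at key
  refine key.trans ?_
  have k1 : E q (fun ω : G.edgeSet → Bool => min ((∑ y, ind (Cn ω a y)) / N) 1) ≤
      100/99 * ε := by
    have : E q (fun ω : G.edgeSet → Bool => min ((∑ y, ind (Cn ω a y)) / N) 1) ≤
        E q (fun ω : G.edgeSet → Bool => (∑ y, ind (Cn ω a y)) * N⁻¹) :=
      Ew_mono (fun _ => q0.le) (fun _ => q1.le) fun ω => min_le_left _ _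
    refine this.trans ?_
    unfold E
    rw [Ew_mul_right]
    change E q _ * _ ≤ _
    rw [sum_Cn]
    have hNi : N⁻¹ ≤ ε ^ 2 := by
      rw [inv_le_comm₀ hNp (by positivity)]; exact hN
    calc ch G q a * N⁻¹ ≤ 100 / (99 * ε) * ε ^ 2 := by gcongr
      _ = 100/99 * ε := by field_simp
  have k2 : (p - q) ^ 2 / (p * (1 - p)) * (Om * ch G q a) ≤ 5 * ε := by
    have e1 : p - q = 2 * (ε * Om⁻¹) := by rw [hp, hq]; ring
    have hpOm : 99/100 ≤ p * Om := by nlinarith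
    have hd : 0 < p * (1 - p) := mul_pos p0 (by linarith)
    rw [e1, div_mul_eq_mul_div, div_le_iff₀ hd]
    have : (2 * (ε * Om⁻¹)) ^ 2 * (Om * ch G q a) ≤ (2 * (ε * Om⁻¹)) ^ 2 * (Om * (100 / (99 * ε))) := by
      gcongr
    refine this.trans ?_
    have e2 : (2 * (ε * Om⁻¹)) ^ 2 * (Om * (100 / (99 * ε))) = 400 / 99 * ε * Om⁻¹ := by
      field_simp; norm_num
    rw [e2]
    have e3 : 5 * ε * (p * (1 - p)) = ε * Om⁻¹ * (5 * (p * Om) * (1 - p)) := by field_simp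
    rw [e3]
    have : 400/99 ≤ 5 * (p * Om) * (1 - p) := by nlinarith
    nlinarith
  linarith

end PercProof
end

noncomputable section
open Classical
set_option linter.unusedSectionVars false

namespace PercProof
open Percolation

variable {V : Type} [Fintype V] [DecidableEq V] {G : SimpleGraph V}

lemma Clus_mono (g : Set V) (a : V) : Monotone (fun ω : G.edgeSet → Bool => a ∈ Clus g ω) := by
  rintro ω ω' h ⟨y, hy, hc⟩
  exact ⟨y, hy, Cn_mono y a h hc⟩

lemma ghost_piv {p : ℝ} (h0 : 0 ≤ p) (h1 : p ≤ 1/2) (g : Set V) (a : V) :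
    ∑ u, ∑ v, ∑ T : Set V, ind (G.Adj u v ∧ a ∉ T ∧ u ∉ T ∧ v ∈ T) *
        (qC G p g T * taS G p Tᶜ a u) ≤
      (1 - p) * dE p (fun ω : G.edgeSet → Bool => ind (a ∈ Clus g ω)) := by
  have := pivotal_bound (p := p) h0 (by linarith) (Clus_mono (G := G) g a)
    (fun u v ω => (G.Adj u v ∧ a ∉ Clus g ω ∧ u ∉ Clus g ω ∧ v ∈ Clus g ω) ∧
      CnS (Clus g ω)ᶜ ω a u) ?_ ?_
  · refine le_trans (le_of_eq ?_) this
    refine Finset.sum_congr rfl fun u _ => Finset.sum_congr rfl fun v _ => ?_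
    exact (cond_clus p g (fun T => G.Adj u v ∧ a ∉ T ∧ u ∉ T ∧ v ∈ T) a u).symm
  · rintro u v ω ⟨⟨hadj, ha, hu, hv⟩, hc⟩
    obtain ⟨y, hy, hyv⟩ := hv
    exact ⟨hadj, ⟨y, hy, Cn_symm (Cn_up _ (CnS_Cn hc) (Cn_symm hyv))⟩, ha⟩
  · rintro u v ω ⟨⟨_, _, hu, hv⟩, _⟩ ⟨⟨_, _, hu', hv'⟩, _⟩
    exact hu' hv

lemma ghost_one (hT : IsTransitive G) {p : ℝ} (h0 : 0 ≤ p) (h1 : p ≤ 1/2) (g : Set V) (a : V) :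
    ch G p a * Pr (fun _ : G.edgeSet => p) (fun ω => a ∉ Clus g ω) -
      E p (fun ω : G.edgeSet → Bool => ind (a ∉ Clus g ω) * ∑ z, ind (Cn ω a z)) ≤
      ch G p a * (p * ((1 - p) * dE p (fun ω : G.edgeSet → Bool => ind (a ∈ Clus g ω)))) := by
  have q1 : p ≤ 1 := by linarith
  set X := ch G p a with hX
  have X0 : 0 ≤ X := ch_nonneg h0 q1 a
  have s1 : ∀ T : Set V, ind (a ∉ T) * (X - ∑ z, taS G p Tᶜ a z) ≤
      p * X * ∑ u, ∑ v, ind (G.Adj u v ∧ a ∉ T ∧ u ∉ T ∧ v ∈ T) * taS G p Tᶜ a u := by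
    intro T
    by_cases ha : a ∈ T
    · rw [ind_false (not_not.mpr ha), zero_mul]
      refine mul_nonneg (mul_nonneg h0 X0) (Finset.sum_nonneg fun _ _ => Finset.sum_nonneg fun _ _ =>
        mul_nonneg (ind_nonneg _) (taS_nonneg h0 q1 _ _ _))
    · rw [ind_true ha, one_mul]
      have t1 := Finset.sum_le_sum fun z (_ : z ∈ Finset.univ) =>
        exit_bound (G := G) h0 h1 (S := Tᶜ) (a := a) ha z
      rw [Finset.sum_add_distrib] at t1
      have t2 : ∑ z, ∑ x, ∑ y, ind (x ∈ Tᶜ ∧ y ∉ Tᶜ ∧ G.Adj x y) *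
          (taS G p Tᶜ a x * (p * ta G p y z)) =
          p * X * ∑ u, ∑ v, ind (G.Adj u v ∧ a ∉ T ∧ u ∉ T ∧ v ∈ T) * taS G p Tᶜ a u := by
        rw [Finset.sum_comm, Finset.mul_sum]
        refine Finset.sum_congr rfl fun u _ => ?_
        rw [Finset.sum_comm, Finset.mul_sum]
        refine Finset.sum_congr rfl fun v _ => ?_
        rw [← Finset.mul_sum, ← Finset.mul_sum, ← Finset.mul_sum]
        change _ * (_ * (p * ch G p v)) = _
        rw [ch_const hT p v a, ← hX]
        have : (u ∈ Tᶜ ∧ v ∉ Tᶜ ∧ G.Adj u v) ↔ (G.Adj u v ∧ a ∉ T ∧ u ∉ T ∧ v ∈ T) := by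
          simp only [Set.mem_compl_iff, not_not]; tauto
        rw [this]; ring
      rw [t2] at t1
      change X ≤ _ at t1
      linarith
  have s2 := ghost_piv (G := G) h0 h1 g a
  have s3 : X * Pr (fun _ : G.edgeSet => p) (fun ω => a ∉ Clus g ω) -
      ∑ z, Pr (fun _ : G.edgeSet => p) (fun ω => a ∉ Clus g ω ∧ CnS (Clus g ω)ᶜ ω a z) ≤
      p * X * ∑ u, ∑ v, ∑ T : Set V, ind (G.Adj u v ∧ a ∉ T ∧ u ∉ T ∧ v ∈ T) *
        (qC G p g T * taS G p Tᶜ a u) := by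
    have e1 : Pr (fun _ : G.edgeSet => p) (fun ω => a ∉ Clus g ω) =
        ∑ T : Set V, ind (a ∉ T) * qC G p g T := cond_clus' p g (fun T => ind (a ∉ T))
    have e2 : ∀ z, Pr (fun _ : G.edgeSet => p) (fun ω => a ∉ Clus g ω ∧ CnS (Clus g ω)ᶜ ω a z) =
        ∑ T : Set V, ind (a ∉ T) * (qC G p g T * taS G p Tᶜ a z) :=
      fun z => cond_clus p g (fun T => a ∉ T) a z
    simp only [e1, e2]
    have e3 : ∑ u, ∑ v, ∑ T : Set V, ind (G.Adj u v ∧ a ∉ T ∧ u ∉ T ∧ v ∈ T) *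
        (qC G p g T * taS G p Tᶜ a u) = ∑ T : Set V, qC G p g T * ∑ u, ∑ v,
          ind (G.Adj u v ∧ a ∉ T ∧ u ∉ T ∧ v ∈ T) * taS G p Tᶜ a u := by
      simp only [Finset.mul_sum]
      rw [Finset.sum_comm (s := (Finset.univ : Finset (Set V)))]
      refine Finset.sum_congr rfl fun u _ => ?_
      rw [Finset.sum_comm (s := (Finset.univ : Finset (Set V)))]
      refine Finset.sum_congr rfl fun v _ => Finset.sum_congr rfl fun T _ => by ring
    rw [e3, Finset.mul_sum, Finset.sum_comm, Finset.mul_sum, ← Finset.sum_sub_distrib]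
    refine Finset.sum_le_sum fun T _ => ?_
    have := mul_le_mul_of_nonneg_left (s1 T) (qC_nonneg (G := G) h0 q1 g T)
    refine le_trans (le_of_eq ?_) (this.trans (le_of_eq (by ring)))
    rw [← Finset.mul_sum, ← Finset.mul_sum]; ring
  have s4 : ∑ z, Pr (fun _ : G.edgeSet => p) (fun ω => a ∉ Clus g ω ∧ CnS (Clus g ω)ᶜ ω a z) ≤
      E p (fun ω : G.edgeSet → Bool => ind (a ∉ Clus g ω) * ∑ z, ind (Cn ω a z)) := by
    unfold Pr E
    rw [← Ew_sum]
    refine Ew_mono (fun _ => h0) (fun _ => q1) fun ω => ?_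
    rw [Finset.mul_sum]
    refine Finset.sum_le_sum fun z _ => ?_
    rw [ind_and]
    exact mul_le_mul_of_nonneg_left (ind_mono CnS_Cn) (ind_nonneg _)
  have s5 := mul_le_mul_of_nonneg_left s2 (mul_nonneg h0 X0)
  have : p * X * ((1 - p) * dE p (fun ω : G.edgeSet → Bool => ind (a ∈ Clus g ω))) =
    X * (p * ((1 - p) * dE p (fun ω : G.edgeSet → Bool => ind (a ∈ Clus g ω)))) := by ring
  linarith

lemma Ew_comm {ι κ : Type} [Fintype ι] [Fintype κ] (P : ι → ℝ) (Q : κ → ℝ)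
    (F : (ι → Bool) → (κ → Bool) → ℝ) :
    Ew P (fun ω => Ew Q (fun σ => F ω σ)) = Ew Q (fun σ => Ew P (fun ω => F ω σ)) := by
  unfold Ew
  simp only [Finset.mul_sum]
  rw [Finset.sum_comm]
  exact Finset.sum_congr rfl fun _ _ => Finset.sum_congr rfl fun _ _ => by ring

lemma dE_Ew {ι κ : Type} [Fintype ι] [Fintype κ] (p : ℝ) (Q : κ → ℝ)
    (F : (ι → Bool) → (κ → Bool) → ℝ) :
    dE p (fun ω => Ew Q (fun σ => F ω σ)) = Ew Q (fun σ => dE p (fun ω => F ω σ)) := by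
  unfold dE
  rw [Ew_sum]
  refine Finset.sum_congr rfl fun e _ => ?_
  unfold E
  rw [← Ew_comm]
  simp only [Ew_sub]

lemma Ew_prod {κ : Type} [Fintype κ] (Q : κ → ℝ) (h : κ → Bool → ℝ) :
    Ew Q (fun σ => ∏ i, h i (σ i)) = ∏ i, (Q i * h i true + (1 - Q i) * h i false) := by
  have h2 := Finset.prod_univ_sum (fun _ : κ => (Finset.univ : Finset Bool))
    (fun i b => bw (Q i) b * h i b)
  rw [Fintype.piFinset_univ] at h2
  unfold Ew Wt
  simp only [← Finset.prod_mul_distrib]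
  rw [← h2]
  refine Finset.prod_congr rfl fun i _ => ?_
  simp [bw]

/-- Cluster size. -/
def sz (a : V) (ω : G.edgeSet → Bool) : ℕ := (Finset.univ.filter (fun y => Cn ω a y)).card

lemma sz_eq (a : V) (ω : G.edgeSet → Bool) : ∑ y, ind (Cn ω a y) = (sz a ω : ℝ) :=
  sum_ind_card _

lemma sz_mono (a : V) : Monotone (fun ω : G.edgeSet → Bool => sz a ω) := by
  intro ω ω' h
  apply Finset.card_le_card
  intro y hy
  simp only [Finset.mem_filter, Finset.mem_univ, true_and] at *
  exact Cn_mono a y h hy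

lemma ghost_avg (γ : ℝ) (a : V) (ω : G.edgeSet → Bool) :
    Ew (fun _ : V => γ) (fun σ => ind (a ∉ Clus {v | σ v = true} ω)) = (1 - γ) ^ sz a ω := by
  have e1 : ∀ σ : V → Bool, ind (a ∉ Clus {v | σ v = true} ω) =
      ∏ y, (if Cn ω a y then ind (σ y = false) else 1) := by
    intro σ
    by_cases h : a ∈ Clus {v | σ v = true} ω
    · rw [ind_false (not_not.mpr h)]
      obtain ⟨y, hy, hc⟩ := h
      symm
      apply Finset.prod_eq_zero (Finset.mem_univ y)
      rw [if_pos (Cn_symm hc)]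
      apply ind_false
      have : σ y = true := hy
      simp [this]
    · rw [ind_true h]
      symm
      apply Finset.prod_eq_one
      intro y _
      split_ifs with hc
      · apply ind_true
        by_contra hs
        exact h ⟨y, by simpa using hs, Cn_symm hc⟩
      · rfl
  simp only [e1]
  rw [Ew_prod (fun _ : V => γ) (fun y b => if Cn ω a y then ind (b = false) else 1)]
  unfold sz
  rw [← Finset.prod_const, Finset.prod_filter]
  refine Finset.prod_congr rfl fun y _ => ?_
  split_ifs
  · rw [ind_false (by simp), ind_true rfl]; ring
  · ring

/-- Ghost connection function. -/
def mg (γ : ℝ) (a : V) (ω : G.edgeSet → Bool) : ℝ := 1 - (1 - γ) ^ sz a ω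

lemma mg_avg (γ : ℝ) (a : V) (ω : G.edgeSet → Bool) :
    Ew (fun _ : V => γ) (fun σ => ind (a ∈ Clus {v | σ v = true} ω)) = mg γ a ω := by
  rw [mg, ← ghost_avg, ← Ew_const (fun _ : V => γ) 1, ← Ew_sub]
  congr 1; ext σ
  rw [ind_not]; ring

lemma ghost_two (hT : IsTransitive G) {p γ : ℝ} (h0 : 0 ≤ p) (h1 : p ≤ 1/2) (g0 : 0 ≤ γ)
    (g1 : γ ≤ 1) (a : V) :
    ch G p a * (1 - E p (fun ω : G.edgeSet → Bool => mg γ a ω)) -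
      E p (fun ω : G.edgeSet → Bool => (1 - γ) ^ sz a ω * sz a ω) ≤
      ch G p a * (p * ((1 - p) * dE p (fun ω : G.edgeSet → Bool => mg γ a ω))) := by
  have := Ew_mono (P := fun _ : V => γ) (fun _ => g0) (fun _ => g1) fun σ : V → Bool =>
    ghost_one (G := G) hT h0 h1 {v | σ v = true} a
  rw [Ew_sub, Ew_mul_left, Ew_mul_left, Ew_mul_left, Ew_mul_left, ← dE_Ew] at this
  simp only [mg_avg] at this
  unfold Pr E at this
  simp only [sz_eq] at this
  have c1 := Ew_comm (fun _ : V => γ) (fun _ : G.edgeSet => p)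
    (fun σ ω => ind (a ∉ Clus {v | σ v = true} ω))
  have c2 := Ew_comm (fun _ : V => γ) (fun _ : G.edgeSet => p)
    (fun σ ω => ind (a ∉ Clus {v | σ v = true} ω) * (sz a ω : ℝ))
  rw [c1, c2] at this
  simp only [Ew_mul_right, ghost_avg] at this
  have e : E p (fun ω : G.edgeSet → Bool => mg γ a ω) =
      1 - Ew (fun _ : G.edgeSet => p) (fun ω => (1 - γ) ^ sz a ω) := by
    unfold E mg
    rw [Ew_sub, Ew_const]
  rw [e]
  unfold E
  linarith

lemma mg_lower {γ : ℝ} (g0 : 0 ≤ γ) (g1 : γ ≤ 1) (n : ℕ) :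
    γ * ((1 - γ) ^ n * n) ≤ 1 - (1 - γ) ^ n := by
  have h1 : 1 + (n : ℝ) * γ ≤ (1 + γ) ^ n := one_add_mul_le_pow (by linarith) n
  have h2 : 0 ≤ (1 - γ) ^ n := pow_nonneg (by linarith) n
  have h3 : (1 + γ) ^ n * (1 - γ) ^ n ≤ 1 := by
    rw [← mul_pow]
    apply pow_le_one₀ <;> nlinarith
  nlinarith [mul_le_mul_of_nonneg_right h1 h2]

lemma mg_upper {γ : ℝ} (g0 : 0 ≤ γ) (g1 : γ ≤ 1) (n : ℕ) :
    1 - (1 - γ) ^ n ≤ n * γ := by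
  have h1 : 1 + (n : ℝ) * (-γ) ≤ (1 + (-γ)) ^ n := one_add_mul_le_pow (by linarith) n
  rw [← sub_eq_add_neg] at h1
  linarith

lemma ghost_three (hT : IsTransitive G) {p γ : ℝ} (h0 : 0 ≤ p) (h1 : p ≤ 1/2) (g0 : 0 < γ)
    (g1 : γ ≤ 1) (a : V) :
    ch G p a * (1 - E p (fun ω : G.edgeSet → Bool => mg γ a ω)) -
      γ⁻¹ * E p (fun ω : G.edgeSet → Bool => mg γ a ω) ≤
      ch G p a * (p * ((1 - p) * dE p (fun ω : G.edgeSet → Bool => mg γ a ω))) := by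
  refine le_trans (sub_le_sub le_rfl ?_) (ghost_two hT h0 h1 g0.le g1 a)
  rw [le_inv_mul_iff₀ g0]
  unfold E
  rw [← Ew_mul_left]
  exact Ew_mono (fun _ => h0) (fun _ => by linarith) fun ω => mg_lower g0.le g1 _

lemma mg_mono {γ : ℝ} (g0 : 0 ≤ γ) (g1 : γ ≤ 1) (a : V) :
    Monotone (fun ω : G.edgeSet → Bool => mg γ a ω) := by
  intro ω ω' h
  unfold mg
  exact sub_le_sub le_rfl (pow_le_pow_of_le_one (by linarith) (by linarith) (sz_mono a h))

lemma mg_nonneg {γ : ℝ} (g0 : 0 ≤ γ) (g1 : γ ≤ 1) (a : V) (ω : G.edgeSet → Bool) :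
    0 ≤ mg γ a ω := by
  unfold mg
  linarith [pow_le_one₀ (n := sz a ω) (by linarith : 0 ≤ 1 - γ) (by linarith)]

/-- Lower bound on the magnetization. -/
lemma mag_lower (hT : IsTransitive G) {Om pc p γ ε : ℝ} (hOm : 0 < Om) (pc0 : 0 < pc)
    (hpO : pc * Om ≤ 3) (ε0 : 0 < ε) (ε1 : ε ≤ 1) (hp : p = pc + ε * Om⁻¹) (p1 : p ≤ 1/2)
    (g0 : 0 < γ) (g1 : γ ≤ 1) (a : V) (hg : γ⁻¹ * ε ≤ 2 * ch G pc a) :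
    ε / 8 ≤ E p (fun ω : G.edgeSet → Bool => mg γ a ω) := by
  by_contra hlt
  push Not at hlt
  have hinv : 0 < ε * Om⁻¹ := by positivity
  have hle : pc ≤ p := by linarith
  have p0 : 0 < p := by linarith
  have hd : ∀ x, HasDerivAt (fun x => E x (fun ω : G.edgeSet → Bool => mg γ a ω) - (2 * p)⁻¹ * x)
      (dE x (fun ω : G.edgeSet → Bool => mg γ a ω) - (2 * p)⁻¹ * 1) x := fun x =>
    HasDerivAt.sub (russo_up _ x) ((hasDerivAt_id x).const_mul _)
  have hm : MonotoneOn (fun x => E x (fun ω : G.edgeSet → Bool => mg γ a ω) - (2 * p)⁻¹ * x)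
      (Set.Icc pc p) := by
    apply monotoneOn_of_deriv_nonneg (convex_Icc pc p)
    · exact fun x _ => (hd x).continuousAt.continuousWithinAt
    · exact fun x _ => (hd x).differentiableAt.differentiableWithinAt
    · intro x hx
      have hx := interior_subset hx
      have x0 : 0 < x := by linarith [hx.1]
      have x2 : x ≤ 1/2 := hx.2.trans p1
      rw [(hd x).deriv]
      have k := ghost_three (G := G) hT x0.le x2 g0 g1 a
      have mM : E x (fun ω : G.edgeSet → Bool => mg γ a ω) ≤ ε / 8 :=
        (E_mono_p (mg_mono g0.le g1 a) x0.le hx.2 (by linarith)).trans hlt.le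
      set M := E x (fun ω : G.edgeSet → Bool => mg γ a ω) with hM
      set D := dE x (fun ω : G.edgeSet → Bool => mg γ a ω) with hD
      have X1 := ch_ge_one (G := G) x0.le (by linarith) a
      have Xm := ch_mono (G := G) pc0.le hx.1 (by linarith) a
      set X := ch G x a with hX
      have gi : 0 < γ⁻¹ := by positivity
      have k2 : γ⁻¹ * M ≤ X / 4 := by nlinarith
      have k3 : X * (1/2) ≤ X * (x * ((1 - x) * D)) := by nlinarith
      have k4 : 1/2 ≤ x * ((1 - x) * D) := le_of_mul_le_mul_left k3 (by linarith)
      have k5 : 0 < D := by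
        by_contra h
        push Not at h
        have : x * ((1 - x) * D) ≤ 0 := mul_nonpos_of_nonneg_of_nonpos x0.le
          (mul_nonpos_of_nonneg_of_nonpos (by linarith) h)
        linarith
      have k6 : 1/2 ≤ p * D := by
        have : (1 - x) * D ≤ D := by nlinarith
        have : x * ((1 - x) * D) ≤ x * D := mul_le_mul_of_nonneg_left this x0.le
        have : x * D ≤ p * D := mul_le_mul_of_nonneg_right hx.2 k5.le
        linarith
      have : (2 * p)⁻¹ ≤ D := by
        rw [inv_le_iff_one_le_mul₀ (by linarith)]; linarith
      linarith
  have h := hm ⟨le_rfl, hle⟩ ⟨hle, le_rfl⟩ hle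
  simp only at h
  have n0 : 0 ≤ E pc (fun ω : G.edgeSet → Bool => mg γ a ω) :=
    Ew_nonneg (fun _ => pc0.le) (fun _ => by linarith) fun ω => mg_nonneg g0.le g1 a ω
  have e1 : ε / 8 ≤ (2 * p)⁻¹ * (p - pc) := by
    have : p - pc = ε * Om⁻¹ := by rw [hp]; ring
    rw [this]
    have pO : p * Om ≤ 4 := by
      have : p * Om = pc * Om + ε := by rw [hp]; field_simp
      linarith
    have e2 : (2 * p)⁻¹ * (ε * Om⁻¹) = ε / (2 * (p * Om)) := by field_simp
    rw [e2]
    have : 0 < p * Om := by positivity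
    exact div_le_div_of_nonneg_left ε0.le (by positivity) (by linarith)
  nlinarith

lemma lower (hT : IsTransitive G) {Om : ℝ} (hOm : 99 ≤ Om) (hreg : ∀ u, ∑ v, ind (G.Adj u v) = Om)
    {pc : ℝ} (hpc : pc ≤ 1/100) (hpO : 99/100 ≤ pc * Om)
    (htri : ∀ u v, G.Adj u v → ∑ z, ∑ w, ta G pc u z * ta G pc z w * ta G pc w v ≤ 1/100) (a : V)
    {ε p N : ℝ} (hε : 0 < ε) (ε1 : ε ≤ 1) (hp : p = pc + ε * Om⁻¹) (p1 : p ≤ 1)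
    (hN : (ε ^ 2)⁻¹ ≤ N) (hNX : 216 * (N * ε) ≤ ch G pc a) :
    1/16 * ε ≤ Pr (fun _ : G.edgeSet => p) (fun ω => N ≤ (sz a ω : ℝ)) := by
  have Om0 : 0 < Om := by linarith
  have pc0 : 0 < pc := by
    by_contra h
    nlinarith
  have N1 : 1 ≤ N := by
    refine le_trans ?_ hN
    rw [one_le_inv₀ (by positivity)]
    nlinarith
  have pO : pc * Om ≤ 3 := by
    have := an_int (G := G) hT Om0.le hreg (c := 1/100) (by norm_num) (by linarith) htri a le_rfl
      pc0.le
    have Y := ch_ge_one (G := G) pc0.le (by linarith) a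
    have Y0 := ch_ge_one (G := G) le_rfl zero_le_one a
    have Y' : 0 < (ch G pc a)⁻¹ := by positivity
    have Y2 : (ch G 0 a)⁻¹ ≤ 1 := inv_le_one_of_one_le₀ Y0
    nlinarith
  have hsm : ε * Om⁻¹ ≤ 1/99 := by
    rw [← div_eq_mul_inv, div_le_iff₀ Om0]; linarith
  have hpos : 0 < ε * Om⁻¹ := by positivity
  have g0 : 0 < (432 * N)⁻¹ := by positivity
  have g1 : (432 * N)⁻¹ ≤ 1 := inv_le_one_of_one_le₀ (by linarith)
  have m1 := mag_lower (G := G) hT Om0 pc0 pO hε ε1 hp (by linarith) g0 g1 a (by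
    rw [inv_inv]; linarith)
  have m2 := upper (G := G) hT hOm hreg hpc hpO htri a hε hp p1 hN
  have m3 : E p (fun ω : G.edgeSet → Bool => mg (432 * N)⁻¹ a ω) ≤
      E p (fun ω : G.edgeSet → Bool => ind (N ≤ (sz a ω : ℝ)) +
        432⁻¹ * min ((∑ y, ind (Cn ω a y)) / N) 1) := by
    refine Ew_mono (fun _ => by linarith) (fun _ => p1) fun ω => ?_
    rw [sz_eq]
    have hmin : 0 ≤ min ((sz a ω : ℝ) / N) 1 := le_min (by positivity) zero_le_one
    by_cases h : N ≤ (sz a ω : ℝ)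
    · rw [ind_true h]
      have : 0 ≤ (1 - (432 * N)⁻¹) ^ sz a ω := pow_nonneg (by linarith) _
      unfold mg
      linarith
    · rw [ind_false h]
      push Not at h
      have h2 : (sz a ω : ℝ) / N ≤ 1 := by rw [div_le_one (by linarith)]; exact h.le
      rw [min_eq_left h2]
      have := mg_upper g0.le g1 (sz a ω)
      unfold mg
      refine this.trans (le_of_eq ?_)
      rw [mul_inv]; ring
  unfold E at m3
  rw [Ew_add, Ew_mul_left] at m3
  unfold E at m1 m2
  unfold Pr
  linarith

end PercProof
end

noncomputable section
open Classical
set_option linter.unusedSectionVars false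

namespace PercProof
open Percolation

variable {V : Type} [Fintype V] [DecidableEq V] {G : SimpleGraph V}

lemma weight_eq (p : ℝ) (ω : G.edgeSet → Bool) :
    weight G p ω = Wt (fun _ : G.edgeSet => p) ω := by
  unfold weight Wt bw
  congr!

lemma expect_eq (p : ℝ) (f : (G.edgeSet → Bool) → ℝ) :
    expect G p f = Ew (fun _ : G.edgeSet => p) f := by
  unfold expect Ew
  refine Finset.sum_bij (fun ω _ => ω) (fun ω _ => ?_) (fun _ _ _ _ h => h)
    (fun ω _ => ⟨ω, ?_, rfl⟩) (fun ω _ => ?_)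
  · exact @Finset.mem_univ (G.edgeSet → Bool) (_) ω
  · apply Finset.mem_univ
  · exact congrArg (· * f ω) (weight_eq p ω)

lemma prob_eq (p : ℝ) (A : (G.edgeSet → Bool) → Prop) :
    prob G p A = Pr (fun _ : G.edgeSet => p) A := by
  rw [Pr, ← expect_eq]
  unfold prob expect
  refine Finset.sum_congr rfl fun ω _ => ?_
  by_cases h : A ω
  · rw [if_pos h]
    exact (mul_one (weight G p ω)).symm.trans
      (congrArg (weight G p ω * ·) (ind_true h).symm)
  · rw [if_neg h]
    exact (mul_zero (weight G p ω)).symm.trans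
      (congrArg (weight G p ω * ·) (ind_false h).symm)

lemma tau_eq (p : ℝ) (x y : V) : tau G p x y = ta G p x y := prob_eq _ _

lemma card_cluster (ω : G.edgeSet → Bool) (a : V) : (cluster G ω a).card = sz a ω := by
  unfold cluster sz
  congr!

lemma chi_eq (p : ℝ) (a : V) : chi G a p = ch G p a := by
  unfold chi
  rw [← sum_Cn]
  refine (expect_eq p _).trans ?_
  unfold E
  congr 1; ext ω
  exact (congrArg (Nat.cast : ℕ → ℝ) (card_cluster ω a)).trans (sz_eq a ω).symm

lemma Pgeq_eq (p N : ℝ) (a : V) :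
    Pgeq G a p N = Pr (fun _ : G.edgeSet => p) (fun ω => N ≤ (sz a ω : ℝ)) := by
  unfold Pgeq
  refine (prob_eq p _).trans ?_
  congr 1; ext ω
  rw [show (cluster G ω a).card = sz a ω from card_cluster ω a]

lemma triangle_eq (p : ℝ) (x y : V) :
    triangle G p x y = ∑ z, ∑ w, ta G p x z * ta G p z w * ta G p w y := by
  unfold triangle
  simp only [tau_eq]

lemma reg_eq [DecidableRel G.Adj] {Om : ℕ} (h : G.IsRegularOfDegree Om) (u : V) :
    ∑ v, ind (G.Adj u v) = (Om : ℝ) := by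
  rw [sum_ind_card, ← h u, ← SimpleGraph.card_neighborFinset_eq_degree,
    SimpleGraph.neighborFinset_eq_filter]
  congr!

lemma pc_le_tri {p : ℝ} (h0 : 0 ≤ p) (h1 : p ≤ 1) {x y : V} (h : G.Adj x y) :
    p ≤ ∑ z, ∑ w, ta G p x z * ta G p z w * ta G p w y := by
  have n : ∀ s t, 0 ≤ ta G p s t := ta_nonneg h0 h1
  have l1 : p ≤ ta G p x y := by
    have := Pr_mono (P := fun _ : G.edgeSet => p) (A := Op x y) (B := fun ω => Cn ω x y)
      (fun _ => h0) (fun _ => h1) (fun ω hw => SimpleGraph.Adj.reachable hw)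
    rw [Pr_Op h] at this
    exact this
  have l2 := Finset.single_le_sum (f := fun w => ta G p x x * ta G p x w * ta G p w y)
    (fun w _ => mul_nonneg (mul_nonneg (n _ _) (n _ _)) (n _ _)) (Finset.mem_univ x)
  have l3 := Finset.single_le_sum (f := fun z => ∑ w, ta G p x z * ta G p z w * ta G p w y)
    (fun z _ => Finset.sum_nonneg fun w _ => mul_nonneg (mul_nonneg (n _ _) (n _ _)) (n _ _))
    (Finset.mem_univ x)
  simp only [ta_self, one_mul] at l2 l3
  linarith

lemma CnS_single {a z : V} {ω : G.edgeSet → Bool} (h : CnS {a} ω a z) : z = a := by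
  obtain ⟨w⟩ := h
  cases w with
  | nil => rfl
  | cons hab q =>
    exfalso
    have h1 := hab.2.1
    have h2 := hab.2.2
    have h3 := hab.1.ne
    simp only [Set.mem_singleton_iff] at h1 h2
    exact h3 h2.symm

lemma ch_rec (hT : IsTransitive G) {Om : ℝ} (hreg : ∀ u, ∑ v, ind (G.Adj u v) = Om)
    {p : ℝ} (h0 : 0 ≤ p) (h1 : p ≤ 1/2) (a : V) : ch G p a ≤ 1 + p * Om * ch G p a := by
  have q1 : p ≤ 1 := by linarith
  have X0 := ch_nonneg (G := G) h0 q1 a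
  have t1 := Finset.sum_le_sum fun z (_ : z ∈ Finset.univ) =>
    exit_bound (G := G) h0 h1 (S := {a}) (a := a) rfl z
  rw [Finset.sum_add_distrib] at t1
  have a1 : ∑ z, taS G p {a} a z ≤ 1 := by
    rw [Finset.sum_eq_single a]
    · exact Pr_le_one (fun _ => h0) (fun _ => q1) _
    · intro z _ hz
      unfold taS Pr
      rw [← Ew_const (fun _ : G.edgeSet => p) 0]
      congr 1; ext ω
      exact ind_false fun h => hz (CnS_single h)
    · simp
  have a2 : ∑ z, ∑ x, ∑ y, ind (x ∈ ({a} : Set V) ∧ y ∉ ({a} : Set V) ∧ G.Adj x y) *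
      (taS G p {a} a x * (p * ta G p y z)) ≤ p * Om * ch G p a := by
    rw [Finset.sum_comm, Finset.sum_eq_single a]
    · rw [Finset.sum_comm]
      have : ∀ y, ∑ z, ind (a ∈ ({a} : Set V) ∧ y ∉ ({a} : Set V) ∧ G.Adj a y) *
          (taS G p {a} a a * (p * ta G p y z)) ≤ ind (G.Adj a y) * (p * ch G p a) := by
        intro y
        rw [← Finset.mul_sum, ← Finset.mul_sum, ← Finset.mul_sum]
        change _ * (_ * (p * ch G p y)) ≤ _
        rw [ch_const hT p y a]
        have b1 : taS G p {a} a a ≤ 1 := Pr_le_one (fun _ => h0) (fun _ => q1) _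
        have b0 := taS_nonneg (G := G) h0 q1 {a} a a
        have pX : 0 ≤ p * ch G p a := mul_nonneg h0 X0
        refine mul_le_mul (ind_mono fun h => h.2.2) ?_ (mul_nonneg b0 pX) (ind_nonneg _)
        nlinarith
      refine (Finset.sum_le_sum fun y _ => this y).trans ?_
      rw [← Finset.sum_mul, hreg]
      exact le_of_eq (by ring)
    · intro x _ hx
      refine Finset.sum_eq_zero fun z _ => Finset.sum_eq_zero fun y _ => ?_
      rw [ind_false, zero_mul]
      rintro ⟨h, _⟩
      exact hx h
    · simp
  change ch G p a ≤ _ at t1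
  linarith

end PercProof
end


open Percolation in
/-- Theorem 1.6(i) (The percolation probability): upper and lower bounds
on `θ_α(p)` above the critical threshold. -/
theorem percolation_probability_bounds :
    ∃ b₀ : ℝ, 0 < b₀ ∧
      ∀ lam α : ℝ, 0 < lam → 0 < α → α < 1 →
      ∃ b₉ b₁₀ : ℝ, 0 < b₉ ∧ 0 < b₁₀ ∧
        ∀ (V : Type) [Fintype V] [DecidableEq V]
          (G : SimpleGraph V) [DecidableRel G.Adj],
          G.Connected → IsTransitive G →
          ∀ Ω : ℕ, G.IsRegularOfDegree Ω →
          ∀ (x₀ : V),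
          1 < lam * (Fintype.card V : ℝ) ^ ((1 : ℝ) / 3) →
          lam * (Fintype.card V : ℝ) ^ ((1 : ℝ) / 3) < (Fintype.card V : ℝ) →
          b₀⁻¹ ≤ lam * (Fintype.card V : ℝ) ^ ((1 : ℝ) / 3) →
          ∀ pc : ℝ, 0 < pc → pc < 1 →
          chi G x₀ pc = lam * (Fintype.card V : ℝ) ^ ((1 : ℝ) / 3) →
          ∀ a₀ : ℝ, a₀ ≤ b₀ →
          (∀ x y : V, triangle G pc x y ≤ kron x y + a₀) →
          ∀ ε p : ℝ, p = pc + ε * (Ω : ℝ)⁻¹ →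
          ∀ Nα : ℝ,
            Nα = (ε ^ 2)⁻¹ * (ε * (Fintype.card V : ℝ) ^ ((1 : ℝ) / 3)) ^ α →
          ((b₉ * ((Fintype.card V : ℝ) ^ ((1 : ℝ) / 3))⁻¹ ≤ ε → ε ≤ 1 → p ≤ 1 →
              b₁₀ * ε ≤ Pgeq G x₀ p Nα) ∧
            (1 ≤ ε * (Fintype.card V : ℝ) ^ ((1 : ℝ) / 3) → p ≤ 1 →
              Pgeq G x₀ p Nα ≤ 27 * ε)) := by
  refine ⟨1/100, by norm_num, fun lam α hlam hα0 hα1 => ?_⟩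
  refine ⟨max 1 ((216 / lam) ^ (1 - α)⁻¹), 1/16, lt_of_lt_of_le one_pos (le_max_left _ _),
    by norm_num, ?_⟩
  intro V _ _ G _ hconn hT Ω hreg0 a hl1 hl2 hl3 pc pc0 pc1 hchi a₀ ha₀ htri0 ε p hp N hN
  have hV1 : (1 : ℝ) < Fintype.card V := hl1.trans hl2
  set W := (Fintype.card V : ℝ) ^ ((1 : ℝ) / 3) with hW
  have W0 : 0 < W := by positivity
  rw [PercProof.chi_eq] at hchi
  have hreg : ∀ u, ∑ v, PercProof.ind (G.Adj u v) = (Ω : ℝ) := PercProof.reg_eq hreg0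
  have htri : ∀ u v, G.Adj u v → ∑ z, ∑ w, PercProof.ta G pc u z * PercProof.ta G pc z w *
      PercProof.ta G pc w v ≤ 1/100 := by
    intro u v huv
    have := htri0 u v
    rw [PercProof.triangle_eq, kron, if_neg huv.ne] at this
    linarith
  have hpc : pc ≤ 1/100 := by
    have hnt : Nontrivial V := by
      rw [← Fintype.one_lt_card_iff_nontrivial]; exact_mod_cast hV1
    obtain ⟨b, hb⟩ := hconn.preconnected.exists_adj_of_nontrivial a
    exact (PercProof.pc_le_tri pc0.le pc1.le hb).trans (htri _ _ hb)
  have hX : 100 ≤ PercProof.ch G pc a := by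
    rw [hchi]; norm_num at hl3 ⊢; exact hl3
  have hpO : 99/100 ≤ pc * (Ω : ℝ) := by
    have := PercProof.ch_rec hT hreg pc0.le (by linarith) a
    by_contra h
    push Not at h
    nlinarith
  have hOm : (99 : ℝ) ≤ Ω := by
    by_contra h
    push Not at h
    nlinarith
  have main : 1 ≤ ε * W → 0 < ε ∧ (ε ^ 2)⁻¹ ≤ N := by
    intro h
    have e0 : 0 < ε := by
      by_contra hh
      push Not at hh
      nlinarith
    refine ⟨e0, ?_⟩
    rw [hN]
    have := Real.one_le_rpow h hα0.le
    have h2 : 0 < (ε ^ 2)⁻¹ := by positivity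
    nlinarith
  rw [PercProof.Pgeq_eq]
  constructor
  · intro h9 hε1 p1
    have ht : max 1 ((216 / lam) ^ (1 - α)⁻¹) ≤ ε * W := by
      rw [← div_eq_mul_inv, div_le_iff₀ W0] at h9; exact h9
    have h1 : 1 ≤ ε * W := (le_max_left _ _).trans ht
    obtain ⟨e0, hN1⟩ := main h1
    refine PercProof.lower hT hOm hreg hpc hpO htri a e0 hε1 hp p1 hN1 ?_
    rw [hchi]
    have t0 : 0 < ε * W := by linarith
    have h2 : (216 / lam) ^ (1 - α)⁻¹ ≤ ε * W := (le_max_right _ _).trans ht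
    have h3 : 216 / lam ≤ (ε * W) ^ (1 - α) := by
      have := Real.rpow_le_rpow (by positivity) h2 (by linarith : 0 ≤ 1 - α)
      rw [← Real.rpow_mul (by positivity), inv_mul_cancel₀ (by linarith), Real.rpow_one] at this
      exact this
    have h4 : (ε * W) ^ (1 - α) * (ε * W) ^ α = ε * W := by
      rw [← Real.rpow_add t0]; simp
    have h5 : 0 < (ε * W) ^ α := Real.rpow_pos_of_pos t0 _
    rw [div_le_iff₀ hlam] at h3
    have h6 : 216 * (ε * W) ^ α ≤ lam * (ε * W) := by
      calc 216 * (ε * W) ^ α ≤ (ε * W) ^ (1 - α) * lam * (ε * W) ^ α := by gcongr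
        _ = lam * ((ε * W) ^ (1 - α) * (ε * W) ^ α) := by ring
        _ = lam * (ε * W) := by rw [h4]
    have h7 : 216 * (N * ε) = ε⁻¹ * (216 * (ε * W) ^ α) := by
      rw [hN]; field_simp
    rw [h7, inv_mul_le_iff₀ e0]
    linarith
  · intro h1 p1
    obtain ⟨e0, hN1⟩ := main h1
    refine le_trans ?_ (PercProof.upper hT hOm hreg hpc hpO htri a e0 hp p1 hN1)
    have hN0 : 0 < N := lt_of_lt_of_le (by positivity) hN1
    have hp0 : 0 ≤ p := by rw [hp]; positivity
    refine PercProof.Ew_mono (fun _ => hp0) (fun _ => p1) fun ω => ?_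
    rw [PercProof.sz_eq]
    by_cases h : N ≤ (PercProof.sz a ω : ℝ)
    · rw [PercProof.ind_true h, le_min_iff, le_div_iff₀ hN0]
      exact ⟨by linarith, le_rfl⟩
    · rw [PercProof.ind_false h]
      exact le_min (by positivity) zero_le_one
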